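/- arXiv:2010.06728 — 4 statements merged into one kernel-verified Lean document; each statement's English description precedes it below -/
import Mathlib

section
/- Let Ω ⊆ ℝ^d be a compact C²-domain with boundary Γ = ∂Ω. Then there exist finitely many domains of special type G_1,…,G_{m₀} ⊆ Ω, each attached to Γ, whose union covers Γ. Moreover, for any prescribed ε > 0 these domains can be chosen so that the base size b_j of each G_j is at most ε and the parameter L_j of each G_j satisfies L_j ≥ 4√d · max_{x ∈ [−2b_j, 2b_j]^{d−1}} ‖∇g_j(x)‖ + 1, where g_j is the C² function describing the essential boundary of G_j. -/
open MeasureTheory Set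
open scoped ENNReal
noncomputable section

/-- `Ω ⊆ ℝ^d` is a compact `C²`-domain, with `ν` the unit outer normal field on `∂Ω`. -/
def IsCompactC2Domain {d : ℕ} (Ω : Set (EuclideanSpace ℝ (Fin d)))
    (ν : EuclideanSpace ℝ (Fin d) → EuclideanSpace ℝ (Fin d)) : Prop :=
  IsCompact Ω ∧
  ∃ κ₀ : ℝ, 0 < κ₀ ∧
    ∃ (J : ℕ) (U : Fin J → Set (EuclideanSpace ℝ (Fin d))),
      (∀ j, IsOpen (U j)) ∧
      frontier Ω ⊆ ⋃ j, U j ∧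
      (∀ j, ∃ Φ : EuclideanSpace ℝ (Fin d) → ℝ,
        ContDiff ℝ 2 Φ ∧
        U j ∩ frontier Ω = {ξ | ξ ∈ U j ∧ Φ ξ = 0} ∧
        ∀ ξ ∈ U j ∩ frontier Ω,
          gradient Φ ξ ≠ 0 ∧ ν ξ = ‖gradient Φ ξ‖⁻¹ • gradient Φ ξ) ∧
      ∀ ξ ∈ frontier Ω,
        ‖ν ξ‖ = 1 ∧
        Metric.ball (ξ - κ₀ • ν ξ) κ₀ ⊆ Ω ∧
        Metric.ball (ξ + κ₀ • ν ξ) κ₀ ⊆ Ωᶜ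

/-- The metric `ρ_Ω(ξ,η) = ‖ξ-η‖ + |√dist(ξ,∂Ω) − √dist(η,∂Ω)|`. -/
def rhoMetric {d : ℕ} (Ω : Set (EuclideanSpace ℝ (Fin d)))
    (ξ η : EuclideanSpace ℝ (Fin d)) : ℝ :=
  dist ξ η + |Real.sqrt (Metric.infDist ξ (frontier Ω)) -
    Real.sqrt (Metric.infDist η (frontier Ω))|

/-- The ball `U(ξ,t) = {η ∈ Ω : ρ_Ω(ξ,η) ≤ t}`. -/
def Uball {d : ℕ} (Ω : Set (EuclideanSpace ℝ (Fin d))) (ξ : EuclideanSpace ℝ (Fin d)) (t : ℝ) :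
    Set (EuclideanSpace ℝ (Fin d)) := {η ∈ Ω | rhoMetric Ω ξ η ≤ t}

/-- `f` is (the evaluation of) a real polynomial in `d` variables of total degree at most `n`. -/
def IsPolyDeg {d : ℕ} (n : ℕ) (f : EuclideanSpace ℝ (Fin d) → ℝ) : Prop :=
  ∃ P : MvPolynomial (Fin d) ℝ, P.totalDegree ≤ n ∧
    ∀ x : EuclideanSpace ℝ (Fin d), f x = MvPolynomial.eval (fun i => x i) P

/-- Data describing a domain of special type in `ℝ^d`: an upward (`s = 1`) or downward
(`s = -1`) `x_k`-domain with base point `base`, base size `b`, parameter `L`, and a `C²`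
function `g` of the remaining `d-1` coordinates (encoded as a function on `ℝ^d` that does
not depend on the `k`-th coordinate).  Permuting coordinates is realized by the choice of the
vertical coordinate `k`, and the reflection by the sign `s`. -/
structure SpecialDomain (d : ℕ) where
  k : Fin d
  s : ℝ
  base : EuclideanSpace ℝ (Fin d)
  b : ℝ
  L : ℝ
  g : EuclideanSpace ℝ (Fin d) → ℝ
  s_unit : s = 1 ∨ s = -1
  b_pos : 0 < b
  L_ge : 1 ≤ L
  g_smooth : ContDiff ℝ 2 g
  g_indep : ∀ ξ η : EuclideanSpace ℝ (Fin d), (∀ i, i ≠ k → ξ i = η i) → g ξ = g η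

namespace SpecialDomain

variable {d : ℕ} (D : SpecialDomain d)

/-- The set `G(λ)`. -/
def lamSet (lam : ℝ) : Set (EuclideanSpace ℝ (Fin d)) :=
  {ξ | (∀ i, i ≠ D.k → (ξ - D.base) i ∈ Set.Ioo (-(lam * D.b)) (lam * D.b)) ∧
       D.g (ξ - D.base) - lam * D.L * D.b < D.s * ((ξ - D.base) D.k) ∧
       D.s * ((ξ - D.base) D.k) ≤ D.g (ξ - D.base)}

/-- The underlying set `G = G(1)` of the special domain. -/
def carrier : Set (EuclideanSpace ℝ (Fin d)) := D.lamSet 1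

/-- `min_{u ∈ [-2b,2b]^{d-1}} g(u)`. -/
def gMin : ℝ :=
  sInf (D.g '' {u : EuclideanSpace ℝ (Fin d) | ∀ i, u i ∈ Set.Icc (-(2 * D.b)) (2 * D.b)})

/-- The enlarged set `G*`. -/
def star : Set (EuclideanSpace ℝ (Fin d)) :=
  {ξ | (∀ i, i ≠ D.k → (ξ - D.base) i ∈ Set.Ioo (-(2 * D.b)) (2 * D.b)) ∧
       D.gMin - 4 * D.L * D.b < D.s * ((ξ - D.base) D.k) ∧
       D.s * ((ξ - D.base) D.k) ≤ D.g (ξ - D.base)}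

/-- The essential boundary `∂'G(λ)`. -/
def essBnd (lam : ℝ) : Set (EuclideanSpace ℝ (Fin d)) :=
  {ξ | (∀ i, i ≠ D.k → (ξ - D.base) i ∈ Set.Ioo (-(lam * D.b)) (lam * D.b)) ∧
       D.s * ((ξ - D.base) D.k) = D.g (ξ - D.base)}

/-- The special domain `G ⊆ Ω` is attached to the boundary `∂Ω`:
`closure G* ∩ ∂Ω = closure ∂'G(2)` and `G* = Q ∩ Ω` for an open rectangular box `Q`. -/
def Attached (Ω : Set (EuclideanSpace ℝ (Fin d))) : Prop :=
  D.carrier ⊆ Ω ∧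
  closure D.star ∩ frontier Ω = closure (D.essBnd 2) ∧
  ∃ lo hi : Fin d → ℝ,
    D.star = {ξ : EuclideanSpace ℝ (Fin d) | ∀ i, ξ i ∈ Set.Ioo (lo i) (hi i)} ∩ Ω

end SpecialDomain

open Filter Topology

/-- A function that is `C^n` at a point agrees near that point with a globally `C^n` function. -/
theorem ContDiffAt.exists_contDiff_eventuallyEq {E : Type*} [NormedAddCommGroup E]
    [InnerProductSpace ℝ E] {n : ℕ} {f : E → ℝ} {x : E} (hf : ContDiffAt ℝ n f x) :
    ∃ g : E → ℝ, ContDiff ℝ n g ∧ g =ᶠ[𝓝 x] f := by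
  obtain ⟨r, hr, hball⟩ := Metric.eventually_nhds_iff_ball.1 (hf.eventually (by simp))
  let χ : ContDiffBump x := ⟨r / 4, r / 2, by positivity, by linarith⟩
  refine ⟨fun y => χ y * f y, contDiff_iff_contDiffAt.2 fun y => ?_, ?_⟩
  · by_cases hy : y ∈ tsupport χ
    · refine χ.contDiffAt.mul (hball y ?_)
      rw [χ.tsupport_eq] at hy
      exact Metric.closedBall_subset_ball (by change r / 2 < r; linarith) hy
    · have h0 := notMem_tsupport_iff_eventuallyEq.1 hy
      refine (contDiffAt_const (c := (0 : ℝ))).congr_of_eventuallyEq ?_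
      filter_upwards [h0] with z hz
      simp [hz]
  · filter_upwards [χ.eventuallyEq_one] with y hy
    simp [hy]

/-- If an initial piece of an open segment lies in `s` and the segment avoids the frontier of `s`,
then its other endpoint lies in `s`. -/
theorem mem_of_segment_disjoint_frontier {E : Type*} [AddCommGroup E] [Module ℝ E]
    [TopologicalSpace E] [ContinuousAdd E] [ContinuousSMul ℝ E] {s : Set E} {p w : E} {T : ℝ}
    (hT : 0 < T) (hs : ∀ᶠ t : ℝ in 𝓝[>] 0, p + t • w ∈ s)
    (hfr : ∀ t ∈ Ioc 0 T, p + t • w ∉ frontier s) : p + T • w ∈ s := by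
  by_contra hmem
  have hpre : IsPreconnected ((fun t : ℝ => p + t • w) '' Ioc 0 T) :=
    isPreconnected_Ioc.image _ (by fun_prop)
  obtain ⟨t, hts, ht⟩ := (hs.and (Ioc_mem_nhdsGT hT)).exists
  have hcover : ∀ τ ∈ Ioc 0 T, p + τ • w ∈ interior s ∪ interior sᶜ := fun τ hτ => by
    by_contra hτ'
    rw [interior_compl, mem_union, not_or, mem_compl_iff, not_not] at hτ'
    exact hfr τ hτ ⟨hτ'.2, hτ'.1⟩
  have hdisj : Disjoint (interior s) (interior sᶜ) :=
    disjoint_compl_right.mono interior_subset interior_subset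
  obtain ⟨x, -, hx⟩ := hpre _ _ isOpen_interior isOpen_interior
    (by rintro _ ⟨τ, hτ, rfl⟩; exact hcover τ hτ)
    ⟨_, mem_image_of_mem _ ht, (hcover t ht).resolve_right fun h => interior_subset h hts⟩
    ⟨_, mem_image_of_mem _ (right_mem_Ioc.2 hT),
      (hcover T (right_mem_Ioc.2 hT)).resolve_left fun h => hmem (interior_subset h)⟩
  exact disjoint_left.1 hdisj hx.1 hx.2

/-- A direction with positive inner product against a nonzero vector `κ • n` points into the ball
centred at `p + κ • n` through `p`. -/
theorem eventually_add_smul_mem_ball {E : Type*} [NormedAddCommGroup E] [InnerProductSpace ℝ E]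
    {n w : E} {κ : ℝ} (hκ : 0 < κ) (hn : ‖n‖ = 1) (hw : 0 < inner ℝ n w) (p : E) :
    ∀ᶠ t : ℝ in 𝓝[>] 0, p + t • w ∈ Metric.ball (p + κ • n) κ := by
  have hlim : ∀ᶠ t : ℝ in 𝓝[>] 0, t * ‖w‖ ^ 2 < 2 * κ * inner ℝ n w := by
    have hc : Continuous fun t : ℝ => t * ‖w‖ ^ 2 := by fun_prop
    exact nhdsWithin_le_nhds (hc.continuousAt.eventually_lt continuousAt_const
      (by simp; positivity))
  filter_upwards [hlim, self_mem_nhdsWithin] with t ht ht0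
  have ht0 : 0 < t := ht0
  rw [Metric.mem_ball, dist_eq_norm, add_sub_add_left_eq_sub]
  refine lt_of_pow_lt_pow_left₀ 2 hκ.le ?_
  rw [norm_sub_sq_real, norm_smul, norm_smul, hn, inner_smul_left, inner_smul_right,
    real_inner_comm]
  simp only [Real.norm_eq_abs, mul_pow, sq_abs, conj_trivial]
  nlinarith

/-- Coordinate cubes form a neighbourhood basis at the origin. -/
theorem EuclideanSpace.exists_cube_of_eventually {ι : Type*} [Fintype ι]
    {P : EuclideanSpace ℝ ι → Prop} (h : ∀ᶠ u in 𝓝 0, P u) :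
    ∃ r > 0, ∀ u : EuclideanSpace ℝ ι, (∀ i, |u i| < r) → P u := by
  have hc : Tendsto (WithLp.toLp 2 : (ι → ℝ) → EuclideanSpace ℝ ι) (𝓝 0) (𝓝 0) :=
    (PiLp.continuous_toLp 2 _).tendsto' _ _ rfl
  obtain ⟨r, hr, H⟩ := Metric.eventually_nhds_iff.1 (hc.eventually h)
  refine ⟨r, hr, fun u hu => ?_⟩
  exact H (y := u.ofLp) ((dist_pi_lt_iff hr).2 fun i => by simpa [Real.dist_eq] using hu i)

theorem EuclideanSpace.cube_mem_nhds {ι : Type*} [Fintype ι] {r : ℝ} (hr : 0 < r) :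
    ∀ᶠ u : EuclideanSpace ℝ ι in 𝓝 0, ∀ i, |u i| < r := by
  refine eventually_all.2 fun i => ?_
  have hc : Continuous fun u : EuclideanSpace ℝ ι => |u i| := by fun_prop
  exact hc.continuousAt.eventually_lt continuousAt_const (by simpa)

theorem EuclideanSpace.isCompact_cube {ι : Type*} [Fintype ι] (r : ℝ) :
    IsCompact {u : EuclideanSpace ℝ ι | ∀ i, u i ∈ Icc (-r) r} := by
  have := (isCompact_univ_pi fun _ : ι => isCompact_Icc (a := -r) (b := r)).image
    (PiLp.continuous_toLp 2 fun _ : ι => ℝ)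
  convert this using 1
  ext u
  constructor
  · exact fun hu => ⟨u.ofLp, fun i _ => hu i, rfl⟩
  · rintro ⟨v, hv, rfl⟩ i
    exact hv i trivial

/-- The orthogonal projection that replaces the `k`-th coordinate by zero. -/
def eraseCoord {d : ℕ} (k : Fin d) (u : EuclideanSpace ℝ (Fin d)) : EuclideanSpace ℝ (Fin d) :=
  u - u k • EuclideanSpace.single k (1 : ℝ)

theorem eraseCoord_self {d : ℕ} (k : Fin d) (u : EuclideanSpace ℝ (Fin d)) :
    eraseCoord k u k = 0 := by simp [eraseCoord]

theorem eraseCoord_of_ne {d : ℕ} {k i : Fin d} (h : i ≠ k) (u : EuclideanSpace ℝ (Fin d)) :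
    eraseCoord k u i = u i := by simp [eraseCoord, h]

theorem eraseCoord_congr {d : ℕ} {k : Fin d} {u v : EuclideanSpace ℝ (Fin d)}
    (h : ∀ i, i ≠ k → u i = v i) : eraseCoord k u = eraseCoord k v := by
  ext i
  rcases eq_or_ne i k with rfl | hi
  · simp only [eraseCoord_self]
  · simp only [eraseCoord_of_ne hi, h i hi]

theorem contDiff_eraseCoord {d : ℕ} (k : Fin d) {n : WithTop ℕ∞} :
    ContDiff ℝ n (eraseCoord k) := by
  unfold eraseCoord
  fun_prop

theorem eraseCoord_zero {d : ℕ} (k : Fin d) : eraseCoord k 0 = 0 := by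
  simp [eraseCoord]

/-- Near a zero with nonvanishing `k`-th partial derivative, the zero set of a `C²` function is
the graph of a `C²` function of the remaining coordinates. -/
theorem exists_graph_of_fderiv_ne_zero {d : ℕ} {Φ : EuclideanSpace ℝ (Fin d) → ℝ}
    (hΦ : ContDiff ℝ 2 Φ) {ξ₀ : EuclideanSpace ℝ (Fin d)} (h0 : Φ ξ₀ = 0) {k : Fin d}
    (hk : fderiv ℝ Φ ξ₀ (EuclideanSpace.single k 1) ≠ 0) :
    ∃ g : EuclideanSpace ℝ (Fin d) → ℝ, ContDiff ℝ 2 g ∧ g 0 = 0 ∧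
      (∀ u v : EuclideanSpace ℝ (Fin d), (∀ i, i ≠ k → u i = v i) → g u = g v) ∧
      ∀ᶠ u in 𝓝 0, Φ (ξ₀ + u) = 0 ↔ u k = g u := by
  set e : EuclideanSpace ℝ (Fin d) := EuclideanSpace.single k 1 with he
  have hek : e k = 1 := by simp [he]
  have hei : ∀ i, i ≠ k → e i = 0 := fun i hi => by simp [he, hi]
  let F : EuclideanSpace ℝ (Fin d) → EuclideanSpace ℝ (Fin d) := fun ξ => ξ + (Φ ξ - ξ k) • e
  have hFk : ∀ ξ, F ξ k = Φ ξ := fun ξ => by simp [F, hek]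
  have hFi : ∀ ξ, ∀ i, i ≠ k → F ξ i = ξ i := fun ξ i hi => by simp [F, hei i hi]
  have hF : ContDiff ℝ 2 F := by fun_prop
  have hinj : Function.Injective (fderiv ℝ F ξ₀) := by
    have hd : HasFDerivAt F (ContinuousLinearMap.id ℝ _ +
        (fderiv ℝ Φ ξ₀ - EuclideanSpace.proj k).smulRight e) ξ₀ := by
      refine (hasFDerivAt_id ξ₀).add (HasFDerivAt.smul_const ?_ e)
      exact ((hΦ.differentiable (by norm_num)) ξ₀).hasFDerivAt.sub
        (EuclideanSpace.proj (𝕜 := ℝ) k).hasFDerivAt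
    rw [hd.fderiv]
    refine (injective_iff_map_eq_zero _).2 fun v hv => ?_
    have hv' : v + (fderiv ℝ Φ ξ₀ v - v k) • e = 0 := by simpa using hv
    have hvk : v = v k • e := by
      ext i
      rcases eq_or_ne i k with rfl | hi
      · simp [hek]
      · simpa [hei i hi] using congrArg (fun w : EuclideanSpace ℝ (Fin d) => w i) hv'
    have h1 : fderiv ℝ Φ ξ₀ v = 0 := by
      simpa [hek] using congrArg (fun w : EuclideanSpace ℝ (Fin d) => w k) hv'
    rw [hvk, map_smul, smul_eq_mul, mul_eq_zero] at h1
    rw [hvk, h1.resolve_right hk, zero_smul]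
  let F' := (LinearEquiv.ofInjectiveEndo (fderiv ℝ F ξ₀).toLinearMap hinj).toContinuousLinearEquiv
  have hF' : HasFDerivAt F (F' : EuclideanSpace ℝ (Fin d) →L[ℝ] EuclideanSpace ℝ (Fin d)) ξ₀ := by
    have : (F' : EuclideanSpace ℝ (Fin d) →L[ℝ] EuclideanSpace ℝ (Fin d)) = fderiv ℝ F ξ₀ := by
      ext; simp [F']
    rw [this]
    exact (hF.differentiable (by norm_num) ξ₀).hasFDerivAt
  have hFat : ContDiffAt ℝ 2 F ξ₀ := hF.contDiffAt
  let I := hFat.localInverse hF' (by norm_num)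
  have hI : ContDiffAt ℝ 2 I (F ξ₀) := hFat.to_localInverse hF' (by norm_num)
  have hI0 : I (F ξ₀) = ξ₀ := hFat.localInverse_apply_image hF' (by norm_num)
  have hleft : ∀ᶠ ξ in 𝓝 ξ₀, I (F ξ) = ξ :=
    (hFat.hasStrictFDerivAt' hF' (by norm_num)).eventually_left_inverse
  have hright : ∀ᶠ η in 𝓝 (F ξ₀), F (I η) = η :=
    (hFat.hasStrictFDerivAt' hF' (by norm_num)).eventually_right_inverse
  have hψ : ContDiffAt ℝ (2 : ℕ) (fun v => I (F ξ₀ + v) k - ξ₀ k) 0 := by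
    have h1 : ContDiffAt ℝ 2 (fun v => I (F ξ₀ + v)) 0 :=
      ContDiffAt.comp 0 (by rwa [add_zero]) (by fun_prop)
    exact ((EuclideanSpace.proj (𝕜 := ℝ) k).contDiff.contDiffAt.comp 0 h1).sub contDiffAt_const
  obtain ⟨g, hg, hgψ⟩ := hψ.exists_contDiff_eventuallyEq
  have hP : Tendsto (eraseCoord k) (𝓝 0) (𝓝 0) :=
    (contDiff_eraseCoord (n := 2) k).continuous.tendsto' _ _ (eraseCoord_zero k)
  have hadd : Tendsto (fun u => ξ₀ + u) (𝓝 0) (𝓝 ξ₀) :=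
    (continuous_const_add ξ₀).tendsto' _ _ (add_zero _)
  have haddF : Tendsto (fun u => F ξ₀ + u) (𝓝 0) (𝓝 (F ξ₀)) :=
    (continuous_const_add _).tendsto' _ _ (add_zero _)
  refine ⟨g ∘ eraseCoord k, hg.comp (contDiff_eraseCoord k), ?_, fun u v huv => ?_, ?_⟩
  · simp only [Function.comp, eraseCoord_zero]
    rw [hgψ.self_of_nhds]
    simp [hI0]
  · simp only [Function.comp, eraseCoord_congr huv]
  · filter_upwards [hP.eventually hgψ, hadd.eventually hleft,
      (haddF.comp hP).eventually hright] with u hgu hl hr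
    simp only [Function.comp] at hr ⊢
    rw [hgu]
    constructor
    · intro hz
      have hFu : F (ξ₀ + u) = F ξ₀ + eraseCoord k u := by
        ext i
        rcases eq_or_ne i k with rfl | hi
        · rw [hFk, PiLp.add_apply, hFk, eraseCoord_self, hz, h0, add_zero]
        · rw [hFi _ _ hi, PiLp.add_apply, PiLp.add_apply, hFi _ _ hi, eraseCoord_of_ne hi]
      rw [← hFu, hl]
      simp
    · intro huk
      have hIu : I (F ξ₀ + eraseCoord k u) = ξ₀ + u := by
        ext i
        rcases eq_or_ne i k with rfl | hi
        · rw [PiLp.add_apply, huk]; ring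
        · rw [← hFi (I _) i hi, hr, PiLp.add_apply, hFi ξ₀ i hi, PiLp.add_apply,
            eraseCoord_of_ne hi]
      rw [← hIu, ← hFk, hr, PiLp.add_apply, hFk, h0, eraseCoord_self, add_zero]

/-- Near each boundary point, a compact `C²`-domain is the subgraph of a `C²` function of all but
one coordinate. -/
theorem IsCompactC2Domain.exists_local_subgraph {d : ℕ} {Ω : Set (EuclideanSpace ℝ (Fin d))}
    {ν : EuclideanSpace ℝ (Fin d) → EuclideanSpace ℝ (Fin d)} (hΩ : IsCompactC2Domain Ω ν)
    {ξ₀ : EuclideanSpace ℝ (Fin d)} (hξ₀ : ξ₀ ∈ frontier Ω) :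
    ∃ (k : Fin d) (s : ℝ) (g : EuclideanSpace ℝ (Fin d) → ℝ) (r : ℝ),
      (s = 1 ∨ s = -1) ∧ ContDiff ℝ 2 g ∧ g 0 = 0 ∧
      (∀ u v : EuclideanSpace ℝ (Fin d), (∀ i, i ≠ k → u i = v i) → g u = g v) ∧ 0 < r ∧
      ∀ u : EuclideanSpace ℝ (Fin d), (∀ i, |u i| < r) →
        (ξ₀ + u ∈ frontier Ω ↔ s * u k = g u) ∧ (ξ₀ + u ∈ Ω ↔ s * u k ≤ g u) := by
  obtain ⟨hcomp, κ, hκ, J, U, hU, hcov, hΦ, hball⟩ := hΩ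
  obtain ⟨j, hj⟩ := mem_iUnion.1 (hcov hξ₀)
  obtain ⟨Φ, hΦ2, hset, hgrad⟩ := hΦ j
  have hfrΦ : ∀ ξ ∈ U j, ξ ∈ frontier Ω ↔ Φ ξ = 0 := fun ξ hξ => by
    have := Set.ext_iff.1 hset ξ
    simpa [hξ] using this
  obtain ⟨k, hk⟩ : ∃ k, ν ξ₀ k ≠ 0 := by
    by_contra! h
    have h0 : ν ξ₀ = 0 := by ext i; simpa using h i
    simpa [h0] using (hball ξ₀ hξ₀).1
  set e : EuclideanSpace ℝ (Fin d) := EuclideanSpace.single k 1 with he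
  have hek : e k = 1 := by simp [he]
  have hei : ∀ i, i ≠ k → e i = 0 := fun i hi => by simp [he, hi]
  have hν : ∀ ξ ∈ U j ∩ frontier Ω, 0 < ‖gradient Φ ξ‖ ∧
      ν ξ k = ‖gradient Φ ξ‖⁻¹ * fderiv ℝ Φ ξ e := fun ξ hξ => by
    refine ⟨norm_pos_iff.2 (hgrad ξ hξ).1, ?_⟩
    rw [← inner_gradient_left, (hgrad ξ hξ).2]
    rw [he, EuclideanSpace.inner_single_right]
    simp
  have hk' : fderiv ℝ Φ ξ₀ e ≠ 0 := fun h => hk (by rw [(hν ξ₀ ⟨hj, hξ₀⟩).2, h, mul_zero])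
  obtain ⟨s, hs, hsk⟩ : ∃ s : ℝ, (s = 1 ∨ s = -1) ∧ 0 < s * fderiv ℝ Φ ξ₀ e := by
    rcases hk'.lt_or_gt with h | h
    · exact ⟨-1, Or.inr rfl, by linarith⟩
    · exact ⟨1, Or.inl rfl, by linarith⟩
  have hss : s * s = 1 := by rcases hs with rfl | rfl <;> norm_num
  have hsabs : ∀ x : ℝ, |s * x| = |x| := fun x => by rcases hs with rfl | rfl <;> simp
  obtain ⟨g₁, hg₁, hg₁0, hg₁i, hg₁Φ⟩ :=
    exists_graph_of_fderiv_ne_zero hΦ2 ((hfrΦ ξ₀ hj).1 hξ₀) hk'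
  let g : EuclideanSpace ℝ (Fin d) → ℝ := fun u => s * g₁ u
  have hg : ContDiff ℝ 2 g := contDiff_const.mul hg₁
  have hgi : ∀ u v : EuclideanSpace ℝ (Fin d), (∀ i, i ≠ k → u i = v i) → g u = g v :=
    fun u v huv => congrArg (s * ·) (hg₁i u v huv)
  have hadd : Tendsto (fun u => ξ₀ + u) (𝓝 0) (𝓝 ξ₀) :=
    (continuous_const_add ξ₀).tendsto' _ _ (add_zero _)
  have hder : Continuous fun ξ => s * fderiv ℝ Φ ξ e :=
    continuous_const.mul ((hΦ2.continuous_fderiv (by norm_num)).clm_apply continuous_const)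
  have hloc : ∀ᶠ u in 𝓝 0, (ξ₀ + u ∈ frontier Ω ↔ s * u k = g u) ∧
      (ξ₀ + u ∈ frontier Ω → 0 < s * ν (ξ₀ + u) k) := by
    filter_upwards [hg₁Φ, hadd.eventually ((hU j).mem_nhds hj),
      hadd.eventually (hder.continuousAt.eventually_const_lt hsk)] with u h1 h2 h3
    refine ⟨(hfrΦ _ h2).trans (h1.trans ?_), fun hfr => ?_⟩
    · refine ⟨fun h => congrArg (s * ·) h, fun h => ?_⟩
      have := congrArg (s * ·) h
      simpa only [g, ← mul_assoc, hss, one_mul] using this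
    · obtain ⟨hpos, heq⟩ := hν _ ⟨h2, hfr⟩
      rw [heq, mul_left_comm]
      exact mul_pos (inv_pos.2 hpos) h3
  obtain ⟨r₀, hr₀, hcube⟩ := EuclideanSpace.exists_cube_of_eventually hloc
  have hgsmall : ∀ᶠ u in 𝓝 0, |g u| < r₀ :=
    hg.continuous.abs.continuousAt.eventually_lt continuousAt_const (by simpa [g, hg₁0])
  obtain ⟨r, hr, hgr⟩ := EuclideanSpace.exists_cube_of_eventually hgsmall
  refine ⟨k, s, g, min r r₀, hs, hg, by simp [g, hg₁0], hgi, lt_min hr hr₀, fun u hu => ?_⟩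
  have hur₀ : ∀ i, |u i| < r₀ := fun i => (hu i).trans_le (min_le_right _ _)
  have hgu := abs_lt.1 (hgr u fun i => (hu i).trans_le (min_le_left _ _))
  have hy := abs_lt.1 ((hsabs (u k)).trans_lt (hur₀ k))
  refine ⟨(hcube u hur₀).1, ?_⟩
  set w : EuclideanSpace ℝ (Fin d) := s • e with hw
  have hcol : ∀ t : ℝ, |s * u k + t| < r₀ →
      (ξ₀ + (u + t • w) ∈ frontier Ω ↔ s * u k + t = g u) ∧
      (ξ₀ + (u + t • w) ∈ frontier Ω → 0 < s * ν (ξ₀ + (u + t • w)) k) := by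
    intro t ht
    have hcoord : s * (u + t • w) k = s * u k + t := by
      simp only [PiLp.add_apply, PiLp.smul_apply, smul_eq_mul, hw, hek]
      linear_combination t * hss
    have hne : ∀ i, i ≠ k → (u + t • w) i = u i := fun i hi => by simp [hw, hei i hi]
    have := hcube (u + t • w) fun i => by
      rcases eq_or_ne i k with rfl | hi
      · rwa [← hsabs, hcoord]
      · rw [hne i hi]; exact hur₀ i
    rwa [hcoord, hgi _ _ hne] at this
  set T := g u - s * u k with hT
  obtain ⟨hP, hνP⟩ := hcol T (by rw [hT, add_sub_cancel]; exact abs_lt.2 hgu)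
  replace hP := hP.2 (by rw [hT]; ring)
  have hinner : 0 < inner ℝ (ν (ξ₀ + (u + T • w))) w := by
    rw [hw, inner_smul_right, he, EuclideanSpace.inner_single_right]
    simpa using hνP hP
  obtain ⟨hnorm, hin, hout⟩ := hball _ hP
  rcases lt_trichotomy (s * u k) (g u) with hlt | heq | hgt
  · refine iff_of_true ?_ hlt.le
    have hend := mem_of_segment_disjoint_frontier (s := Ω) (p := ξ₀ + (u + T • w)) (w := -w)
      (T := T) (by linarith) ?_ ?_
    · convert hend using 1; module
    · filter_upwards [eventually_add_smul_mem_ball hκ (n := -ν (ξ₀ + (u + T • w))) (w := -w)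
        (by rwa [norm_neg]) (by rwa [inner_neg_neg]) (ξ₀ + (u + T • w))] with t ht
      refine hin ?_
      rwa [smul_neg, ← sub_eq_add_neg] at ht
    · rintro t ⟨ht0, htT⟩ hmem
      have h1 : ξ₀ + (u + T • w) + t • -w = ξ₀ + (u + (T - t) • w) := by module
      rw [h1, (hcol (T - t) (abs_lt.2 ⟨by linarith, by linarith⟩)).1] at hmem
      linarith
  · refine iff_of_true ?_ heq.le
    exact hcomp.isClosed.frontier_subset ((hcube u hur₀).1.2 heq)
  · refine iff_of_false ?_ hgt.not_ge
    have hend := mem_of_segment_disjoint_frontier (s := Ωᶜ) (p := ξ₀ + (u + T • w)) (w := w)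
      (T := -T) (by linarith) ?_ ?_
    · have h1 : ξ₀ + (u + T • w) + -T • w = ξ₀ + u := by module
      rwa [h1] at hend
    · filter_upwards [eventually_add_smul_mem_ball hκ hnorm hinner (ξ₀ + (u + T • w))] with t ht
      exact hout ht
    · rintro t ⟨ht0, htT⟩ hmem
      have h1 : ξ₀ + (u + T • w) + t • w = ξ₀ + (u + (T + t) • w) := by module
      rw [frontier_compl, h1, (hcol (T + t) (abs_lt.2 ⟨by linarith, by linarith⟩)).1] at hmem
      linarith

namespace SpecialDomain

variable {d : ℕ} (D : SpecialDomain d)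

theorem g_eraseCoord (u : EuclideanSpace ℝ (Fin d)) : D.g (eraseCoord D.k u) = D.g u :=
  D.g_indep _ _ fun _ hi => eraseCoord_of_ne hi u

theorem abs_s_mul (x : ℝ) : |D.s * x| = |x| := by
  rcases D.s_unit with h | h <;> simp [h]

theorem s_mul_self : D.s * D.s = 1 := by
  rcases D.s_unit with h | h <;> simp [h]

theorem gMin_le {u : EuclideanSpace ℝ (Fin d)}
    (hu : ∀ i, i ≠ D.k → u i ∈ Icc (-(2 * D.b)) (2 * D.b)) : D.gMin ≤ D.g u := by
  refine csInf_le ((EuclideanSpace.isCompact_cube _).image D.g_smooth.continuous).bddBelow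
    ⟨eraseCoord D.k u, fun i => ?_, D.g_eraseCoord u⟩
  rcases eq_or_ne i D.k with rfl | hi
  · rw [eraseCoord_self]
    constructor <;> linarith [D.b_pos]
  · rw [eraseCoord_of_ne hi]
    exact hu i hi

theorem le_gMin {a : ℝ} (h : ∀ u : EuclideanSpace ℝ (Fin d),
    (∀ i, u i ∈ Icc (-(2 * D.b)) (2 * D.b)) → a ≤ D.g u) : a ≤ D.gMin := by
  refine le_csInf (Nonempty.image _ ⟨0, fun i => ?_⟩) (by rintro _ ⟨u, hu, rfl⟩; exact h u hu)
  constructor <;> simp [D.b_pos.le]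

theorem L_mul_b_pos : 0 < D.L * D.b := mul_pos (by linarith [D.L_ge]) D.b_pos

theorem essBnd_subset_star : D.essBnd 2 ⊆ D.star := fun ξ hξ => by
  refine ⟨hξ.1, ?_, hξ.2.le⟩
  rw [hξ.2]
  linarith [D.gMin_le fun i hi => Ioo_subset_Icc_self (hξ.1 i hi), D.L_mul_b_pos]

theorem closure_star_subset : closure D.star ⊆
    {ξ | (∀ i, i ≠ D.k → (ξ - D.base) i ∈ Icc (-(2 * D.b)) (2 * D.b)) ∧
       D.gMin - 4 * D.L * D.b ≤ D.s * ((ξ - D.base) D.k) ∧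
       D.s * ((ξ - D.base) D.k) ≤ D.g (ξ - D.base)} := by
  refine closure_minimal
    (fun ξ hξ => ⟨fun i hi => Ioo_subset_Icc_self (hξ.1 i hi), hξ.2.1.le, hξ.2.2⟩) ?_
  have hg := D.g_smooth.continuous
  have hc : Continuous fun ξ : EuclideanSpace ℝ (Fin d) => D.s * (ξ - D.base) D.k := by fun_prop
  refine IsClosed.inter (s₁ := {ξ | ∀ i, i ≠ D.k → (ξ - D.base) i ∈ Icc (-(2 * D.b)) (2 * D.b)})
    ?_ (IsClosed.inter (isClosed_le continuous_const hc) (isClosed_le hc (by fun_prop)))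
  simp only [ofPred_forall]
  exact isClosed_iInter fun i => isClosed_iInter fun _ =>
    isClosed_Icc.preimage (f := fun ξ : EuclideanSpace ℝ (Fin d) => (ξ - D.base) i) (by fun_prop)

/-- Points of the graph over the closed cube are limits of points of the graph over the open
cube. -/
theorem mem_closure_essBnd {lam : ℝ} (hlam : 0 < lam) {ξ : EuclideanSpace ℝ (Fin d)}
    (hξ : ∀ i, i ≠ D.k → (ξ - D.base) i ∈ Icc (-(lam * D.b)) (lam * D.b))
    (hg : D.s * ((ξ - D.base) D.k) = D.g (ξ - D.base)) : ξ ∈ closure (D.essBnd lam) := by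
  set u := ξ - D.base
  let γ : ℝ → EuclideanSpace ℝ (Fin d) := fun t => D.base +
    (t • eraseCoord D.k u + (D.s * D.g (t • u)) • EuclideanSpace.single D.k (1 : ℝ))
  have hγ : Continuous γ := by
    have := D.g_smooth.continuous
    fun_prop
  have hγk : ∀ t, (γ t - D.base) D.k = D.s * D.g (t • u) := fun t => by
    simp [γ, eraseCoord_self]
  have hγi : ∀ t i, i ≠ D.k → (γ t - D.base) i = t * u i := fun t i hi => by
    simp [γ, eraseCoord_of_ne hi, hi]
  have hγ1 : γ 1 = ξ := by
    rw [← sub_left_inj (a := D.base)]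
    ext i
    rcases eq_or_ne i D.k with rfl | hi
    · rw [hγk, one_smul, ← hg, ← mul_assoc, D.s_mul_self, one_mul]
    · rw [hγi 1 i hi, one_mul]
  have hmaps : MapsTo γ (Ico 0 1) (D.essBnd lam) := fun t ht => by
    refine ⟨fun i hi => ?_, ?_⟩
    · rw [hγi t i hi, mem_Ioo, ← abs_lt, abs_mul, abs_of_nonneg ht.1]
      have h1 : |u i| ≤ lam * D.b := abs_le.2 (hξ i hi)
      have h2 : 0 < lam * D.b := mul_pos hlam D.b_pos
      nlinarith [ht.1, ht.2, abs_nonneg (u i)]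
    · rw [hγk, ← mul_assoc, D.s_mul_self, one_mul]
      exact D.g_indep _ _ fun i hi => by rw [hγi t i hi]; simp
  rw [← hγ1]
  refine map_mem_closure hγ ?_ hmaps
  rw [closure_Ico zero_ne_one]
  exact right_mem_Icc.2 zero_le_one

/-- `D` agrees with `Ω` inside the coordinate cube of half-side `r` about its base point. -/
def IsSubgraphNear (Ω : Set (EuclideanSpace ℝ (Fin d))) (r : ℝ) : Prop :=
  ∀ u : EuclideanSpace ℝ (Fin d), (∀ i, |u i| < r) →
    (D.base + u ∈ frontier Ω ↔ D.s * u D.k = D.g u) ∧ (D.base + u ∈ Ω ↔ D.s * u D.k ≤ D.g u)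

variable {D} {Ω : Set (EuclideanSpace ℝ (Fin d))} {r : ℝ}

theorem abs_lt_of_mem (hb : 2 * D.b < r)
    (hg : ∀ u : EuclideanSpace ℝ (Fin d),
      (∀ i, i ≠ D.k → u i ∈ Icc (-(2 * D.b)) (2 * D.b)) → D.g u < r)
    (hL : -r < D.gMin - 4 * D.L * D.b) {u : EuclideanSpace ℝ (Fin d)}
    (hu : ∀ i, i ≠ D.k → u i ∈ Icc (-(2 * D.b)) (2 * D.b))
    (hlo : D.gMin - 4 * D.L * D.b ≤ D.s * u D.k) (hhi : D.s * u D.k ≤ D.g u) :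
    ∀ i, |u i| < r := fun i => by
  rcases eq_or_ne i D.k with rfl | hi
  · rw [← D.abs_s_mul]
    exact abs_lt.2 ⟨hL.trans_le hlo, hhi.trans_lt (hg u hu)⟩
  · exact (abs_le.2 (hu i hi)).trans_lt hb

theorem IsSubgraphNear.attached (hD : D.IsSubgraphNear Ω r) (hb : 2 * D.b < r)
    (hg : ∀ u : EuclideanSpace ℝ (Fin d),
      (∀ i, i ≠ D.k → u i ∈ Icc (-(2 * D.b)) (2 * D.b)) → D.g u < r)
    (hL : -r < D.gMin - 4 * D.L * D.b) : D.Attached Ω := by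
  have hbp := D.b_pos
  have hcube : ∀ {u : EuclideanSpace ℝ (Fin d)}, _ → _ → _ → _ :=
    fun {u} h1 h2 h3 => hD u (abs_lt_of_mem hb hg hL h1 h2 h3)
  have hsub : ∀ ξ, D.base + (ξ - D.base) = ξ := fun ξ => add_sub_cancel _ _
  have hstar : D.star ⊆ Ω := fun ξ hξ => by
    rw [← hsub ξ]
    exact (hcube (fun i hi => Ioo_subset_Icc_self (hξ.1 i hi)) hξ.2.1.le hξ.2.2).2.2 hξ.2.2
  refine ⟨?_, ?_, ?_⟩
  · rintro ξ ⟨h1, h2, h3⟩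
    simp only [one_mul] at h1 h2
    have h1' : ∀ i, i ≠ D.k → (ξ - D.base) i ∈ Ioo (-(2 * D.b)) (2 * D.b) := fun i hi =>
      Ioo_subset_Ioo (by linarith) (by linarith) (h1 i hi)
    refine hstar ⟨h1', ?_, h3⟩
    linarith [D.gMin_le fun i hi => Ioo_subset_Icc_self (h1' i hi), D.L_mul_b_pos]
  · apply Subset.antisymm
    · rintro ξ ⟨hξ, hfr⟩
      obtain ⟨h1, h2, h3⟩ := D.closure_star_subset hξ
      rw [← hsub ξ] at hfr
      exact D.mem_closure_essBnd two_pos h1 ((hcube h1 h2 h3).1.1 hfr)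
    · refine subset_inter (closure_mono D.essBnd_subset_star)
        (closure_minimal (fun ξ hξ => ?_) isClosed_frontier)
      obtain ⟨h1, h2, h3⟩ := D.essBnd_subset_star hξ
      rw [← hsub ξ]
      exact (hcube (fun i hi => Ioo_subset_Icc_self (h1 i hi)) h2.le h3).1.2 hξ.2
  · set A := D.gMin - 4 * D.L * D.b
    refine ⟨fun i => D.base i + if i = D.k then min (D.s * A) (D.s * r) else -(2 * D.b),
      fun i => D.base i + if i = D.k then max (D.s * A) (D.s * r) else 2 * D.b, ?_⟩
    have hArp : A < r := by
      have := D.gMin_le (u := 0) fun i _ => by constructor <;> simp [hbp.le]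
      linarith [hg 0 fun i _ => by constructor <;> simp [hbp.le], D.L_mul_b_pos]
    have hk : ∀ x, D.s * x ∈ Ioo A r ↔ x ∈ Ioo (min (D.s * A) (D.s * r))
        (max (D.s * A) (D.s * r)) := fun x => by
      rcases D.s_unit with h | h
      · simp [h, min_eq_left hArp.le, max_eq_right hArp.le]
      · simp only [h, neg_mul, one_mul, min_eq_right (neg_le_neg hArp.le),
          max_eq_left (neg_le_neg hArp.le), mem_Ioo]
        constructor <;> rintro ⟨h1, h2⟩ <;> constructor <;> linarith
    have hbox : ∀ ξ : EuclideanSpace ℝ (Fin d),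
        (∀ i, ξ i ∈ Ioo (D.base i + if i = D.k then min (D.s * A) (D.s * r) else -(2 * D.b))
          (D.base i + if i = D.k then max (D.s * A) (D.s * r) else 2 * D.b)) ↔
        (∀ i, i ≠ D.k → (ξ - D.base) i ∈ Ioo (-(2 * D.b)) (2 * D.b)) ∧
          D.s * ((ξ - D.base) D.k) ∈ Ioo A r := fun ξ => by
      have hshift : ∀ i a b, ξ i ∈ Ioo (D.base i + a) (D.base i + b) ↔
          (ξ - D.base) i ∈ Ioo a b := fun i a b => by
        simp only [mem_Ioo, PiLp.sub_apply]
        constructor <;> rintro ⟨h1, h2⟩ <;> constructor <;> linarith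
      simp only [hshift, hk]
      constructor
      · intro h
        exact ⟨fun i hi => by simpa [hi] using h i, by simpa using h D.k⟩
      · rintro ⟨h1, h2⟩ i
        rcases eq_or_ne i D.k with rfl | hi
        · simpa using h2
        · simpa [hi] using h1 i hi
    ext ξ
    rw [mem_inter_iff, mem_ofPred_eq, hbox]
    constructor
    · exact fun hξ => ⟨⟨hξ.1, hξ.2.1,
        hξ.2.2.trans_lt (hg _ fun i hi => Ioo_subset_Icc_self (hξ.1 i hi))⟩, hstar hξ⟩
    · rintro ⟨⟨h1, h2, h3⟩, hξ⟩
      rw [← hsub ξ] at hξ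
      refine ⟨h1, h2, (hD _ fun i => ?_).2.1 hξ⟩
      rcases eq_or_ne i D.k with rfl | hi
      · rw [← D.abs_s_mul]
        exact abs_lt.2 ⟨hL.trans h2, h3⟩
      · exact (abs_lt.2 (h1 i hi)).trans hb

theorem IsSubgraphNear.eventually_mem_carrier (hD : D.IsSubgraphNear Ω r) (hr : 0 < r) :
    ∀ᶠ ξ in 𝓝 D.base, ξ ∈ frontier Ω → ξ ∈ D.carrier := by
  have hsub : Tendsto (fun ξ => ξ - D.base) (𝓝 D.base) (𝓝 0) :=
    (continuous_sub_right D.base).tendsto' _ _ (sub_self _)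
  filter_upwards [hsub.eventually (EuclideanSpace.cube_mem_nhds hr),
    hsub.eventually (EuclideanSpace.cube_mem_nhds D.b_pos)] with ξ h1 h2 hfr
  rw [← add_sub_cancel D.base ξ] at hfr
  have heq := (hD _ h1).1.1 hfr
  refine ⟨fun i _ => ?_, ?_, heq.le⟩
  · rw [one_mul]
    exact abs_lt.1 (h2 i)
  · rw [heq]
    linarith [D.L_mul_b_pos]

end SpecialDomain

/-- Each boundary point of a compact `C²`-domain has a neighbourhood in the boundary covered by a
single attached domain of special type with small base size and large parameter. -/
theorem IsCompactC2Domain.exists_specialDomain {d : ℕ} {Ω : Set (EuclideanSpace ℝ (Fin d))}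
    {ν : EuclideanSpace ℝ (Fin d) → EuclideanSpace ℝ (Fin d)} (hΩ : IsCompactC2Domain Ω ν)
    {ε : ℝ} (hε : 0 < ε) {ξ₀ : EuclideanSpace ℝ (Fin d)} (hξ₀ : ξ₀ ∈ frontier Ω) :
    ∃ D : SpecialDomain d, D.Attached Ω ∧ D.b ≤ ε ∧
      4 * Real.sqrt d * sSup ((fun x => ‖gradient D.g x‖) ''
        {x : EuclideanSpace ℝ (Fin d) | ∀ i, x i ∈ Icc (-(2 * D.b)) (2 * D.b)}) + 1 ≤ D.L ∧
      ∀ᶠ ξ in 𝓝 ξ₀, ξ ∈ frontier Ω → ξ ∈ D.carrier := by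
  obtain ⟨k, s, g, r, hs, hg, hg0, hgi, hr, hgraph⟩ := hΩ.exists_local_subgraph hξ₀
  have hgrad : Continuous fun x => ‖gradient g x‖ :=
    ((InnerProductSpace.toDual ℝ _).symm.continuous.comp
      (hg.continuous_fderiv (by norm_num))).norm
  let S : ℝ → Set ℝ := fun b => (fun x => ‖gradient g x‖) ''
    {x : EuclideanSpace ℝ (Fin d) | ∀ i, x i ∈ Icc (-(2 * b)) (2 * b)}
  set K := sSup (S 1)
  have hK : 0 ≤ K := Real.sSup_nonneg (by rintro _ ⟨x, -, rfl⟩; exact norm_nonneg _)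
  set L := 4 * Real.sqrt d * K + 1
  have hL1 : 1 ≤ L := le_add_of_nonneg_left (by positivity)
  have hsmall : ∀ᶠ u in 𝓝 0, |g u| < r / 2 :=
    hg.continuous.abs.continuousAt.eventually_lt continuousAt_const (by simpa [hg0])
  obtain ⟨r₁, hr₁, hgr⟩ := EuclideanSpace.exists_cube_of_eventually hsmall
  obtain ⟨b, hb, hb0⟩ : ∃ b : ℝ, (b < 1 ∧ b < ε ∧ 2 * b < r ∧ 2 * b < r₁ ∧ 4 * L * b < r / 2) ∧
      0 < b := by
    have hlt : ∀ c a : ℝ, 0 < a → ∀ᶠ b in 𝓝[>] (0 : ℝ), c * b < a := fun c a ha =>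
      nhdsWithin_le_nhds ((continuous_const_mul c).continuousAt.eventually_lt continuousAt_const
        (by simpa))
    have h := (hlt 1 1 one_pos).and ((hlt 1 ε hε).and ((hlt 2 r hr).and ((hlt 2 r₁ hr₁).and
      (hlt (4 * L) (r / 2) (half_pos hr)))))
    simp only [one_mul] at h
    exact (h.and self_mem_nhdsWithin).exists
  obtain ⟨hb1, hbε, hbr, hbr₁, hbL⟩ := hb
  let D : SpecialDomain d := ⟨k, s, ξ₀, b, L, g, hs, hb0, hL1, hg, hgi⟩
  have hDg : ∀ u : EuclideanSpace ℝ (Fin d),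
      (∀ i, i ≠ D.k → u i ∈ Icc (-(2 * D.b)) (2 * D.b)) → |D.g u| < r / 2 := fun u hu => by
    rw [← D.g_eraseCoord]
    refine hgr _ fun i => ?_
    by_cases hi : i = D.k
    · rwa [hi, eraseCoord_self, abs_zero]
    · rw [eraseCoord_of_ne hi]
      exact (abs_le.2 (hu i hi)).trans_lt hbr₁
  have hD : D.IsSubgraphNear Ω r := hgraph
  refine ⟨D, hD.attached hbr (fun u hu => ?_) ?_, hbε.le, ?_, hD.eventually_mem_carrier hr⟩
  · linarith [(abs_lt.1 (hDg u hu)).2]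
  · have := D.le_gMin (a := -(r / 2)) fun u hu => (abs_lt.1 (hDg u fun i _ => hu i)).1.le
    change -r < D.gMin - 4 * L * b
    linarith
  · have hmono : sSup (S b) ≤ K := by
      refine csSup_le_csSup ((EuclideanSpace.isCompact_cube _).image hgrad).bddAbove
        (Nonempty.image _ ⟨0, fun i => ?_⟩) (image_mono fun x hx i => ?_)
      · constructor <;> simp [hb0.le]
      · exact Icc_subset_Icc (by linarith) (by linarith) (hx i)
    change 4 * Real.sqrt d * sSup (S b) + 1 ≤ L
    exact add_le_add_left (mul_le_mul_of_nonneg_left hmono (by positivity)) 1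

/-- **Proposition 2.5** (decomposition of compact `C²`-domains into domains of special type):
the boundary `∂Ω` can be covered by finitely many domains of special type attached to `∂Ω`,
whose base sizes can be taken arbitrarily small and whose parameters satisfy
`L ≥ 4√d · max ‖∇g‖ + 1`. -/
theorem decomposition_into_special_domains {d : ℕ} (hd : 2 ≤ d)
    (Ω : Set (EuclideanSpace ℝ (Fin d)))
    (ν : EuclideanSpace ℝ (Fin d) → EuclideanSpace ℝ (Fin d))
    (hΩ : IsCompactC2Domain Ω ν) (ε : ℝ) (hε : 0 < ε) :
    ∃ (m₀ : ℕ) (G : Fin m₀ → SpecialDomain d),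
      (∀ j, (G j).carrier ⊆ Ω ∧ (G j).Attached Ω ∧ (G j).b ≤ ε ∧
        4 * Real.sqrt d *
            sSup ((fun x => ‖gradient (G j).g x‖) ''
              {x : EuclideanSpace ℝ (Fin d) |
                ∀ i, x i ∈ Set.Icc (-(2 * (G j).b)) (2 * (G j).b)}) + 1
          ≤ (G j).L) ∧
      frontier Ω ⊆ ⋃ j, (G j).carrier := by
  have hcomp : IsCompact (frontier Ω) :=
    hΩ.1.of_isClosed_subset isClosed_frontier hΩ.1.isClosed.frontier_subset
  choose D hatt hb hL hmem using fun ξ (hξ : ξ ∈ frontier Ω) => hΩ.exists_specialDomain hε hξ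
  obtain ⟨t, hcov⟩ := hcomp.elim_nhds_subcover'
    (fun ξ hξ => {η | η ∈ frontier Ω → η ∈ (D ξ hξ).carrier}) hmem
  let p : Fin t.card → frontier Ω := fun j => t.equivFin.symm j
  refine ⟨t.card, fun j => D _ (p j).2, fun j => ⟨(hatt _ (p j).2).1, hatt _ (p j).2,
    hb _ (p j).2, hL _ (p j).2⟩, fun η hη => ?_⟩
  obtain ⟨ξ, hξ, hηξ⟩ := mem_iUnion₂.1 (hcov hη)
  exact mem_iUnion.2 ⟨t.equivFin ⟨ξ, hξ⟩, by simpa [p] using hηξ hη⟩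
end
end

section
/- Let Ω ⊆ ℝ^d be a compact C²-domain with boundary Γ = ∂Ω. Then there is a constant c ≥ 1 depending only on Ω such that for every ξ ∈ Ω and every t ∈ (0,1), c⁻¹ t^d (√dist(ξ,Γ) + t) ≤ |U(ξ,t)| ≤ c t^d (√dist(ξ,Γ) + t), where |U(ξ,t)| is the Lebesgue measure of U(ξ,t). -/
open MeasureTheory Set
open scoped ENNReal

noncomputable section

section TangentBalls

variable {E : Type*} [NormedAddCommGroup E] [InnerProductSpace ℝ E]

open scoped InnerProductSpace

/-- Every frontier point of `Ω` is touched by a ball of radius `κ` inside `Ω` and by one outside,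
with centres on the line spanned by the unit vector `ν ξ`. -/
def HasTangentBalls (Ω : Set E) (ν : E → E) (κ : ℝ) : Prop :=
  ∀ ξ ∈ frontier Ω, ‖ν ξ‖ = 1 ∧ Metric.ball (ξ - κ • ν ξ) κ ⊆ Ω ∧
    Metric.ball (ξ + κ • ν ξ) κ ⊆ Ωᶜ

theorem ball_infDist_frontier_subset {Ω : Set E} {x : E} (hx : x ∈ Ω) :
    Metric.ball x (Metric.infDist x (frontier Ω)) ⊆ Ω := by
  rcases (Metric.ball x (Metric.infDist x (frontier Ω))).eq_empty_or_nonempty with h0 | h0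
  · simp [h0]
  have hpos : 0 < Metric.infDist x (frontier Ω) := Metric.nonempty_ball.1 h0
  have hdisj : ∀ y ∈ Metric.ball x (Metric.infDist x (frontier Ω)), y ∉ frontier Ω := by
    intro y hy hyf
    have := Metric.infDist_le_dist_of_mem (x := x) hyf
    rw [Metric.mem_ball, dist_comm] at hy
    linarith
  refine Subset.trans ?_ interior_subset
  refine (convex_ball x _).isPreconnected.subset_left_of_subset_union isOpen_interior
    (isClosed_closure (s := Ω)).isOpen_compl ?_ ?_ ?_
  · exact disjoint_left.2 fun y hy hy' => hy' (subset_closure (interior_subset hy))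
  · intro y hy
    by_contra hcon
    simp only [mem_union, mem_compl_iff, not_or, not_not] at hcon
    exact hdisj y hy ⟨hcon.2, hcon.1⟩
  · refine ⟨x, Metric.mem_ball_self hpos, ?_⟩
    by_contra hxi
    exact hdisj x (Metric.mem_ball_self hpos) ⟨subset_closure hx, hxi⟩

theorem mem_of_dist_lt_infDist_frontier {Ω : Set E} {x y : E} (hx : x ∈ Ω)
    (h : dist y x < Metric.infDist x (frontier Ω)) : y ∈ Ω :=
  ball_infDist_frontier_subset hx h

namespace HasTangentBalls

variable {Ω : Set E} {ν : E → E} {κ : ℝ}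

theorem infDist_add_le_norm (hT : HasTangentBalls Ω ν κ) (hκ : 0 < κ) {x z : E} (hx : x ∈ Ω)
    (hz : z ∈ frontier Ω) :
    Metric.infDist x (frontier Ω) + κ ≤ ‖x - z - κ • ν z‖ := by
  have hout := (hT z hz).2.2
  have hrw : ‖x - z - κ • ν z‖ = dist x (z + κ • ν z) := by
    rw [dist_eq_norm]; congr 1; abel
  rw [hrw]
  rcases (Metric.infDist_nonneg (x := x) (s := frontier Ω)).eq_or_lt with h0 | h0
  · rw [← h0, zero_add]
    by_contra! hlt
    exact hout hlt hx
  · exact (disjoint_ball_ball_iff h0 hκ).1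
      (disjoint_left.2 fun y hy hy' => hout hy' (ball_infDist_frontier_subset hx hy))

theorem sub_foot_eq (hT : HasTangentBalls Ω ν κ) (hκ : 0 < κ) {x z : E} (hx : x ∈ Ω)
    (hz : z ∈ frontier Ω) (hxz : Metric.infDist x (frontier Ω) = dist x z) :
    x - z = -(Metric.infDist x (frontier Ω) • ν z) := by
  have h1 := hT.infDist_add_le_norm hκ hx hz
  have hν := (hT z hz).1
  set δ := Metric.infDist x (frontier Ω) with hδ
  have hδ0 : 0 ≤ δ := Metric.infDist_nonneg
  rw [dist_eq_norm] at hxz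
  have h2 : (δ + κ) ^ 2 ≤ ‖x - z - κ • ν z‖ ^ 2 := by gcongr
  rw [norm_sub_sq_real, inner_smul_right, norm_smul, hν, ← hxz, Real.norm_eq_abs, mul_one,
    sq_abs] at h2
  have h3 : δ ≤ -⟪x - z, ν z⟫_ℝ := by
    have : κ * δ ≤ κ * (-⟪x - z, ν z⟫_ℝ) := by nlinarith
    exact le_of_mul_le_mul_left this hκ
  have h4 : ‖x - z + δ • ν z‖ ^ 2 ≤ 0 := by
    rw [norm_add_sq_real, inner_smul_right, norm_smul, hν, ← hxz, Real.norm_eq_abs, mul_one,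
      sq_abs]
    nlinarith
  have h5 : x - z + δ • ν z = 0 := by
    rw [← norm_eq_zero]
    nlinarith [norm_nonneg (x - z + δ • ν z)]
  exact eq_neg_of_add_eq_zero_left h5

theorem mul_norm_normal_sub_le (hT : HasTangentBalls Ω ν κ) (hκ : 0 < κ) {p q : E}
    (hp : p ∈ frontier Ω) (hq : q ∈ frontier Ω) :
    κ ^ 2 * ‖ν p - ν q‖ ^ 2 ≤ ‖p - q‖ ^ 2 := by
  have key : ∀ a ∈ frontier Ω, ∀ b ∈ frontier Ω,
      4 * κ ^ 2 ≤ ‖(a - b) - κ • (ν a + ν b)‖ ^ 2 := by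
    intro a ha b hb
    have h := (disjoint_ball_ball_iff hκ hκ).1
      (disjoint_left.2 fun y hy hy' => (hT b hb).2.2 hy' ((hT a ha).2.1 hy))
    have hrw : dist (a - κ • ν a) (b + κ • ν b) = ‖(a - b) - κ • (ν a + ν b)‖ := by
      rw [dist_eq_norm]; congr 1; module
    rw [hrw] at h
    calc 4 * κ ^ 2 = (κ + κ) ^ 2 := by ring
      _ ≤ _ := by gcongr
  have h1 := key p hp q hq
  have h2 := key q hq p hp
  have hpar := parallelogram_law_with_norm ℝ (ν p) (ν q)
  rw [(hT p hp).1, (hT q hq).1] at hpar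
  rw [norm_sub_sq_real, norm_smul, mul_pow, inner_smul_right, Real.norm_eq_abs, sq_abs] at h1 h2
  have e1 : ⟪q - p, ν q + ν p⟫_ℝ = -⟪p - q, ν p + ν q⟫_ℝ := by
    rw [add_comm (ν q), ← inner_neg_left, neg_sub]
  rw [e1, add_comm (ν q), norm_sub_rev q p] at h2
  nlinarith

theorem inner_normal_ge (hT : HasTangentBalls Ω ν κ) (hκ : 0 < κ) {p q : E}
    (hp : p ∈ frontier Ω) (hq : q ∈ frontier Ω) (hpq : dist p q ≤ κ / 2) :
    3 / 4 ≤ ⟪ν p, ν q⟫_ℝ := by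
  have h := hT.mul_norm_normal_sub_le hκ hp hq
  rw [norm_sub_sq_real, (hT p hp).1, (hT q hq).1, ← dist_eq_norm] at h
  have h2 : dist p q ^ 2 ≤ (κ / 2) ^ 2 := by gcongr
  have h3 : κ ^ 2 * (3 / 4) ≤ κ ^ 2 * ⟪ν p, ν q⟫_ℝ := by nlinarith [sq_nonneg κ]
  exact le_of_mul_le_mul_left h3 (by positivity)

/-- Near a frontier point `p`, moving inwards by `h` along `ν p` stays in `Ω` and increases the
distance to the frontier by at least `h / 2`. -/
theorem infDist_sub_smul_ge (hT : HasTangentBalls Ω ν κ) (hκ : 0 < κ)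
    (hc : IsCompact (frontier Ω)) {p η : E} {h : ℝ}
    (hp : p ∈ frontier Ω) (hη : η ∈ Ω) (hηp : dist η p ≤ κ / 8) (h0 : 0 ≤ h) (hh : h ≤ κ / 8) :
    η - h • ν p ∈ Ω ∧ Metric.infDist η (frontier Ω) + h / 2 ≤
      Metric.infDist (η - h • ν p) (frontier Ω) := by
  have hνp := (hT p hp).1
  have hmem : η - h • ν p ∈ Ω := by
    rcases h0.eq_or_lt with h0 | h0
    · simpa [← h0] using hη
    obtain ⟨q, hq, hηq⟩ := hc.exists_infDist_eq_dist ⟨p, hp⟩ η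
    have hδ : Metric.infDist η (frontier Ω) ≤ κ / 8 :=
      (Metric.infDist_le_dist_of_mem hp).trans hηp
    have hfoot := hT.sub_foot_eq hκ hη hq hηq
    have hpq : dist p q ≤ κ / 2 := by
      have := dist_triangle_left p q η
      linarith
    have hin := hT.inner_normal_ge hκ hp hq hpq
    have hνq := (hT q hq).1
    refine (hT q hq).2.1 ?_
    set δ := Metric.infDist η (frontier Ω) with hδd
    have hδ0 : 0 ≤ δ := Metric.infDist_nonneg
    rw [Metric.mem_ball, dist_eq_norm]
    have e : η - h • ν p - (q - κ • ν q) = (κ - δ) • ν q - h • ν p := by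
      have : η = q - δ • ν q := by rw [sub_eq_iff_eq_add.1 hfoot]; abel
      rw [this]; module
    rw [e]
    refine lt_of_pow_lt_pow_left₀ 2 hκ.le ?_
    rw [norm_sub_sq_real, norm_smul, norm_smul, inner_smul_left, inner_smul_right, hνp, hνq,
      Real.norm_eq_abs, Real.norm_eq_abs, mul_one, mul_one, sq_abs, sq_abs, real_inner_comm]
    simp only [conj_trivial]
    have h7 : 0 < κ - δ := by linarith
    have h8 : (κ - δ) * (h * (3 / 4)) ≤ (κ - δ) * (h * ⟪ν p, ν q⟫_ℝ) := by gcongr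
    nlinarith [mul_pos h0 hκ, mul_nonneg hδ0 hκ.le, mul_nonneg h0.le hδ0]
  refine ⟨hmem, ?_⟩
  set x := η - h • ν p with hx
  obtain ⟨z, hz, hxz⟩ := hc.exists_infDist_eq_dist ⟨p, hp⟩ x
  have hxη : dist x η = h := by
    rw [dist_eq_norm, hx, sub_sub_cancel_left, norm_neg, norm_smul, hνp, mul_one,
      Real.norm_of_nonneg h0]
  have hxp : dist x p ≤ κ / 4 := by
    have := dist_triangle x η p
    linarith
  have hδx : Metric.infDist x (frontier Ω) ≤ κ / 4 :=
    (Metric.infDist_le_dist_of_mem hp).trans hxp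
  have hpz : dist p z ≤ κ / 2 := by
    have := dist_triangle_left p z x
    linarith
  have hin := hT.inner_normal_ge hκ hp hz hpz
  have hfoot := hT.sub_foot_eq hκ hmem hz hxz
  have hext := hT.infDist_add_le_norm hκ hη hz
  have hνz := (hT z hz).1
  have hδ0 : 0 ≤ Metric.infDist x (frontier Ω) := Metric.infDist_nonneg
  have hδη : 0 ≤ Metric.infDist η (frontier Ω) := Metric.infDist_nonneg
  set δ := Metric.infDist η (frontier Ω)
  set δ' := Metric.infDist x (frontier Ω)
  have e : η - z - κ • ν z = h • ν p - (δ' + κ) • ν z := by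
    have h1 : η = x + h • ν p := by rw [hx]; abel
    have h2 : x = z - δ' • ν z := by rw [sub_eq_iff_eq_add.1 hfoot]; abel
    rw [h1, h2]; module
  have hsq : (δ + κ) ^ 2 ≤ ‖η - z - κ • ν z‖ ^ 2 := by gcongr
  rw [e, norm_sub_sq_real, norm_smul, norm_smul, inner_smul_left, inner_smul_right, hνp, hνz,
      Real.norm_eq_abs, Real.norm_eq_abs, mul_one, mul_one, sq_abs, sq_abs] at hsq
  simp only [conj_trivial] at hsq
  have h8 : h * ((δ' + κ) * (3 / 4)) ≤ h * ((δ' + κ) * ⟪ν p, ν z⟫_ℝ) := by gcongr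
  have h9 : (δ + κ) ^ 2 ≤ (δ' + κ - h / 2) ^ 2 := by
    nlinarith [mul_nonneg h0 hδ0, mul_nonneg h0 (sub_nonneg.2 hh)]
  have h10 : δ + κ ≤ δ' + κ - h / 2 := le_of_sq_le_sq h9 (by linarith)
  linarith

end HasTangentBalls

end TangentBalls

section Translates

variable {E : Type*} [NormedAddCommGroup E] [NormedSpace ℝ E] [MeasurableSpace E] [BorelSpace E]
  {μ : Measure E} [μ.IsAddRightInvariant]

omit [NormedSpace ℝ E] in
theorem measureReal_preimage_add_right' (A : Set E) (v : E) :
    μ.real ((fun x => x + v) ⁻¹' A) = μ.real A := by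
  simp only [Measure.real, measure_preimage_add_right]

theorem nat_mul_measureReal_le_of_translates {A B : Set E} (hA : MeasurableSet A)
    (hAB : A ⊆ B) (hB : μ B ≠ ∞) (v : E) (N : ℕ)
    (hsub : ∀ a ∈ A, ∀ k < N, a - (k : ℝ) • v ∈ B)
    (hdisj : ∀ a ∈ A, ∀ k < N, 0 < k → a - (k : ℝ) • v ∉ A) :
    N * μ.real A ≤ μ.real B := by
  have hmeas : ∀ k : ℕ, MeasurableSet ((fun x => x + (k : ℝ) • v) ⁻¹' A) := fun k =>
    (measurableSet_preimage (continuous_add_const _).measurable hA)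
  have hfin : μ A ≠ ∞ := measure_ne_top_of_subset hAB hB
  have hpair : ∀ i < N, ∀ j < N, i < j →
      Disjoint ((fun x => x + (i : ℝ) • v) ⁻¹' A) ((fun x => x + (j : ℝ) • v) ⁻¹' A) := by
    intro i hi j hj hij
    refine disjoint_left.2 fun y hy hy' => hdisj _ hy' (j - i) (by omega) (by omega) ?_
    have : y + (j : ℝ) • v - ((j - i : ℕ) : ℝ) • v = y + (i : ℝ) • v := by
      rw [Nat.cast_sub hij.le]; module
    rw [this]
    exact hy
  have hun : μ.real (⋃ k ∈ Finset.range N, (fun x => x + (k : ℝ) • v) ⁻¹' A) = N * μ.real A := by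
    rw [measureReal_biUnion_finset (fun i hi j hj hij => ?_) (fun k _ => hmeas k)
      (fun k _ => by rwa [measure_preimage_add_right])]
    · simp [measureReal_preimage_add_right']
    · simp only [Finset.coe_range, mem_Iio] at hi hj
      rcases lt_or_gt_of_ne hij with h | h
      · exact hpair i hi j hj h
      · exact (hpair j hj i hi h).symm
  rw [← hun]
  refine measureReal_mono ?_ hB
  refine iUnion₂_subset fun k hk y hy => ?_
  have := hsub _ hy k (Finset.mem_range.1 hk)
  simpa using this

theorem measureReal_le_nat_mul_of_translates {A B : Set E} (hA : μ A ≠ ∞) (v : E) (N : ℕ)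
    (hcov : ∀ b ∈ B, ∃ k < N, b + (k : ℝ) • v ∈ A) :
    μ.real B ≤ N * μ.real A := by
  have hfin : μ (⋃ k ∈ Finset.range N, (fun x => x + (k : ℝ) • v) ⁻¹' A) ≠ ∞ := by
    refine (measure_biUnion_lt_top (Finset.finite_toSet _) fun k _ => ?_).ne
    rw [measure_preimage_add_right]
    exact hA.lt_top
  calc μ.real B ≤ μ.real (⋃ k ∈ Finset.range N, (fun x => x + (k : ℝ) • v) ⁻¹' A) := by
        refine measureReal_mono (fun b hb => ?_) hfin
        obtain ⟨k, hk, hbk⟩ := hcov b hb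
        exact mem_iUnion₂.2 ⟨k, Finset.mem_range.2 hk, hbk⟩
    _ ≤ ∑ k ∈ Finset.range N, μ.real ((fun x => x + (k : ℝ) • v) ⁻¹' A) :=
        measureReal_biUnion_finset_le _ _
    _ = N * μ.real A := by simp [measureReal_preimage_add_right']

end Translates

section Uball

variable {d : ℕ} {Ω : Set (EuclideanSpace ℝ (Fin d))}
  {ν : EuclideanSpace ℝ (Fin d) → EuclideanSpace ℝ (Fin d)} {ξ : EuclideanSpace ℝ (Fin d)}

theorem Uball_subset_closedBall (Ω : Set (EuclideanSpace ℝ (Fin d)))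
    (ξ : EuclideanSpace ℝ (Fin d)) (t : ℝ) : Uball Ω ξ t ⊆ Metric.closedBall ξ t := by
  intro η hη
  have h := hη.2
  rw [rhoMetric] at h
  rw [Metric.mem_closedBall, dist_comm]
  linarith [abs_nonneg (√(Metric.infDist ξ (frontier Ω)) - √(Metric.infDist η (frontier Ω)))]

theorem measure_Uball_ne_top (Ω : Set (EuclideanSpace ℝ (Fin d)))
    (ξ : EuclideanSpace ℝ (Fin d)) (t : ℝ) : volume (Uball Ω ξ t) ≠ ∞ :=
  measure_ne_top_of_subset (Uball_subset_closedBall Ω ξ t) measure_closedBall_lt_top.ne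

theorem Uball_mono (Ω : Set (EuclideanSpace ℝ (Fin d)))
    (ξ : EuclideanSpace ℝ (Fin d)) {t t' : ℝ} (h : t ≤ t') : Uball Ω ξ t ⊆ Uball Ω ξ t' :=
  fun _ hη => ⟨hη.1, hη.2.trans h⟩

theorem measurableSet_Uball (hΩ : IsClosed Ω) (ξ : EuclideanSpace ℝ (Fin d)) (t : ℝ) :
    MeasurableSet (Uball Ω ξ t) := by
  have hcont : Continuous (rhoMetric Ω ξ) := by
    unfold rhoMetric
    have := Metric.continuous_infDist_pt (frontier Ω)
    fun_prop
  exact (hΩ.inter (isClosed_le hcont continuous_const)).measurableSet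

theorem measureReal_closedBall_eq (x : EuclideanSpace ℝ (Fin d)) {r : ℝ} (hr : 0 ≤ r) :
    volume.real (Metric.closedBall x r) =
      r ^ d * volume.real (Metric.ball (0 : EuclideanSpace ℝ (Fin d)) 1) := by
  simpa using Measure.addHaar_real_closedBall (volume : Measure (EuclideanSpace ℝ (Fin d))) x hr

theorem measureReal_ball_eq (x : EuclideanSpace ℝ (Fin d)) {r : ℝ} (hr : 0 < r) :
    volume.real (Metric.ball x r) =
      r ^ d * volume.real (Metric.ball (0 : EuclideanSpace ℝ (Fin d)) 1) := by
  have h : 0 ≤ r ^ d := by positivity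
  simp [Measure.real, Measure.addHaar_ball_of_pos _ x hr, ENNReal.toReal_ofReal h]

theorem abs_infDist_sub_le_of_mem_Uball {η η' : EuclideanSpace ℝ (Fin d)} {t : ℝ}
    (hη : η ∈ Uball Ω ξ t) (hη' : η' ∈ Uball Ω ξ t) :
    Metric.infDist η' (frontier Ω) - Metric.infDist η (frontier Ω) ≤
      4 * (t * (√(Metric.infDist ξ (frontier Ω)) + t)) := by
  have h := hη.2
  have h' := hη'.2
  rw [rhoMetric] at h h'
  have e := Real.sq_sqrt (Metric.infDist_nonneg (x := η) (s := frontier Ω))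
  have e' := Real.sq_sqrt (Metric.infDist_nonneg (x := η') (s := frontier Ω))
  have hp := Real.sqrt_nonneg (Metric.infDist η (frontier Ω))
  have hp' := Real.sqrt_nonneg (Metric.infDist η' (frontier Ω))
  rw [← e, ← e']
  set a := √(Metric.infDist η (frontier Ω))
  set a' := √(Metric.infDist η' (frontier Ω))
  have hs := Real.sqrt_nonneg (Metric.infDist ξ (frontier Ω))
  set s := √(Metric.infDist ξ (frontier Ω))
  have hd := dist_nonneg (x := ξ) (y := η)
  have hd' := dist_nonneg (x := ξ) (y := η')
  have h1 := abs_le.1 (show |s - a| ≤ t by linarith)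
  have h2 := abs_le.1 (show |s - a'| ≤ t by linarith)
  have ht : 0 ≤ t := by linarith
  calc a' ^ 2 - a ^ 2 = (a' - a) * (a' + a) := by ring
    _ ≤ (2 * t) * (2 * (s + t)) := by
        refine mul_le_mul (by linarith) (by linarith) (by linarith) (by linarith)
    _ = 4 * (t * (s + t)) := by ring

theorem measureReal_Uball_le_near (hΩ : IsClosed Ω) {κ : ℝ} (hT : HasTangentBalls Ω ν κ)
    (hκ : 0 < κ) (hc : IsCompact (frontier Ω)) (hne : (frontier Ω).Nonempty) {t : ℝ}
    (ht : 0 < t) (htκ : t ≤ κ / 16) (hξ : Metric.infDist ξ (frontier Ω) ≤ κ / 16) :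
    volume.real (Uball Ω ξ t) ≤
      16 * 2 ^ d * volume.real (Metric.ball (0 : EuclideanSpace ℝ (Fin d)) 1) *
        (t ^ d * (√(Metric.infDist ξ (frontier Ω)) + t)) := by
  obtain ⟨p, hp, hξp⟩ := hc.exists_infDist_eq_dist hne ξ
  have hνp := (hT p hp).1
  have hs := Real.sqrt_nonneg (Metric.infDist ξ (frontier Ω))
  set s := √(Metric.infDist ξ (frontier Ω)) with hsd
  set h := 16 * (t * (s + t)) with hh
  have hh0 : 0 < h := by positivity
  set N := ⌊t / h⌋₊ + 1 with hN
  have hkh : ∀ k < N, k * h ≤ t := by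
    intro k hk
    have : (k : ℝ) ≤ t / h :=
      (Nat.cast_le.2 (Nat.lt_succ_iff.1 hk)).trans (Nat.floor_le (by positivity))
    rwa [le_div_iff₀ hh0] at this
  have hpack : N * volume.real (Uball Ω ξ t) ≤ volume.real (Metric.closedBall ξ (2 * t)) := by
    refine nat_mul_measureReal_le_of_translates (measurableSet_Uball hΩ ξ t)
      ((Uball_subset_closedBall Ω ξ t).trans (Metric.closedBall_subset_closedBall (by linarith)))
      measure_closedBall_lt_top.ne (h • ν p) N ?_ ?_
    · intro a ha k hk
      have h1 := Uball_subset_closedBall Ω ξ t ha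
      rw [Metric.mem_closedBall] at h1 ⊢
      have h2 : dist (a - (k : ℝ) • h • ν p) a ≤ t := by
        rw [dist_eq_norm, sub_sub_cancel_left, norm_neg, smul_smul, norm_smul, hνp, mul_one,
          Real.norm_of_nonneg (by positivity)]
        exact hkh k hk
      linarith [dist_triangle (a - (k : ℝ) • h • ν p) a ξ]
    · intro a ha k hk hk0 hmem
      have h1 := Uball_subset_closedBall Ω ξ t ha
      rw [Metric.mem_closedBall] at h1
      have h2 : dist a p ≤ κ / 8 := by linarith [dist_triangle a ξ p]
      have h3 := (hT.infDist_sub_smul_ge hκ hc hp ha.1 h2 (h := k * h) (by positivity)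
        (by linarith [hkh k hk])).2
      rw [← smul_smul] at h3
      have h4 := abs_infDist_sub_le_of_mem_Uball ha hmem
      have h5 : h ≤ k * h := le_mul_of_one_le_left hh0.le (by exact_mod_cast hk0)
      linarith
  rw [measureReal_closedBall_eq ξ (by linarith : (0 : ℝ) ≤ 2 * t)] at hpack
  have hNt : t / h ≤ N := by
    rw [hN]; push_cast; exact (Nat.lt_floor_add_one _).le
  have h6 : t / h * volume.real (Uball Ω ξ t) ≤
      (2 * t) ^ d * volume.real (Metric.ball (0 : EuclideanSpace ℝ (Fin d)) 1) :=
    (mul_le_mul_of_nonneg_right hNt measureReal_nonneg).trans hpack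
  have h7 : t / h = 1 / (16 * (s + t)) := by
    rw [hh]; field_simp
  have h8 : 0 < s + t := by positivity
  rw [h7, div_mul_eq_mul_div, one_mul, div_le_iff₀ (by positivity), mul_pow] at h6
  linarith

theorem measureReal_Uball_le_far {t r : ℝ} (ht : 0 ≤ t) (hr : 0 < r)
    (h : r ≤ √(Metric.infDist ξ (frontier Ω)) + t) :
    volume.real (Uball Ω ξ t) ≤
      r⁻¹ * volume.real (Metric.ball (0 : EuclideanSpace ℝ (Fin d)) 1) *
        (t ^ d * (√(Metric.infDist ξ (frontier Ω)) + t)) := by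
  have h1 := measureReal_mono (μ := volume) (Uball_subset_closedBall Ω ξ t)
    measure_closedBall_lt_top.ne
  rw [measureReal_closedBall_eq ξ ht] at h1
  refine h1.trans ?_
  have h2 : 0 ≤ t ^ d * volume.real (Metric.ball (0 : EuclideanSpace ℝ (Fin d)) 1) := by positivity
  have h3 : 1 ≤ r⁻¹ * (√(Metric.infDist ξ (frontier Ω)) + t) := by
    rw [inv_mul_eq_div, one_le_div hr]; exact h
  nlinarith

theorem ball_subset_Uball (hξ : ξ ∈ Ω) {t r : ℝ} (ht0 : 0 ≤ t) (hr : 0 < r) (hr1 : r ≤ 1)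
    (ht : r * t / 2 ≤ r ^ 2) (h : r ≤ √(Metric.infDist ξ (frontier Ω))) :
    Metric.ball ξ (r * t / 2) ⊆ Uball Ω ξ t := by
  intro η hη
  rw [Metric.mem_ball] at hη
  have e := Real.sq_sqrt (Metric.infDist_nonneg (x := ξ) (s := frontier Ω))
  have hlip : |Metric.infDist ξ (frontier Ω) - Metric.infDist η (frontier Ω)| ≤ dist ξ η := by
    rw [abs_le]
    have h1 := Metric.infDist_le_infDist_add_dist (s := frontier Ω) (x := ξ) (y := η)
    have h2 := Metric.infDist_le_infDist_add_dist (s := frontier Ω) (x := η) (y := ξ)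
    rw [dist_comm] at h2
    constructor <;> linarith
  have e' := Real.sq_sqrt (Metric.infDist_nonneg (x := η) (s := frontier Ω))
  have ha := Real.sqrt_nonneg (Metric.infDist η (frontier Ω))
  refine ⟨mem_of_dist_lt_infDist_frontier hξ ?_, ?_⟩
  · refine hη.trans_le (ht.trans ?_)
    rw [← e]; gcongr
  rw [rhoMetric]
  rw [← e, ← e'] at hlip
  set s := √(Metric.infDist ξ (frontier Ω))
  set a := √(Metric.infDist η (frontier Ω))
  rw [sq_sub_sq, abs_mul, abs_of_nonneg (by linarith : 0 ≤ s + a)] at hlip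
  rw [dist_comm] at hη
  have h1 : r * |s - a| ≤ r * (t / 2) :=
    calc r * |s - a| ≤ (s + a) * |s - a| := by gcongr; linarith
      _ ≤ r * t / 2 := hlip.trans hη.le
      _ = r * (t / 2) := by ring
  have h2 := le_of_mul_le_mul_left h1 hr
  have h3 : r * t ≤ 1 * t := by gcongr
  linarith

theorem le_measureReal_Uball_far (hξ : ξ ∈ Ω) {t r S : ℝ} (ht0 : 0 < t) (hr : 0 < r) (hr1 : r ≤ 1)
    (ht : t ≤ r) (h : r ≤ √(Metric.infDist ξ (frontier Ω)))
    (hS : √(Metric.infDist ξ (frontier Ω)) + t ≤ S) :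
    (r / 2) ^ d * S⁻¹ * volume.real (Metric.ball (0 : EuclideanSpace ℝ (Fin d)) 1) *
        (t ^ d * (√(Metric.infDist ξ (frontier Ω)) + t)) ≤ volume.real (Uball Ω ξ t) := by
  have h1 := measureReal_mono (μ := volume)
    (ball_subset_Uball hξ ht0.le hr hr1 (by nlinarith) h) (measure_Uball_ne_top Ω ξ t)
  rw [measureReal_ball_eq ξ (by positivity)] at h1
  refine le_trans ?_ h1
  have hS0 : 0 < S := by linarith
  have h3 : S⁻¹ * (√(Metric.infDist ξ (frontier Ω)) + t) ≤ 1 := by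
    rw [inv_mul_eq_div, div_le_one hS0]; exact hS
  have h2 : 0 ≤ (r * t / 2) ^ d * volume.real (Metric.ball (0 : EuclideanSpace ℝ (Fin d)) 1) := by
    positivity
  have h4 : (r * t / 2) ^ d = (r / 2) ^ d * t ^ d := by rw [← mul_pow]; ring
  calc _ = (r * t / 2) ^ d * volume.real (Metric.ball (0 : EuclideanSpace ℝ (Fin d)) 1) *
        (S⁻¹ * (√(Metric.infDist ξ (frontier Ω)) + t)) := by rw [h4]; ring
    _ ≤ _ := mul_le_of_le_one_right h2 h3

theorem mem_Uball_of_infDist_mem_Icc {η : EuclideanSpace ℝ (Fin d)} {t : ℝ} (ht : 0 ≤ t)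
    (hη : η ∈ Ω) (hd : dist η ξ ≤ t / 2)
    (h1 : Metric.infDist ξ (frontier Ω) ≤ Metric.infDist η (frontier Ω))
    (h2 : Metric.infDist η (frontier Ω) ≤ Metric.infDist ξ (frontier Ω) +
      t * (√(Metric.infDist ξ (frontier Ω)) + t) / 4) :
    η ∈ Uball Ω ξ t := by
  refine ⟨hη, ?_⟩
  rw [rhoMetric, abs_sub_comm, abs_of_nonneg (sub_nonneg.2 (Real.sqrt_le_sqrt h1)), dist_comm]
  have e := Real.sq_sqrt (Metric.infDist_nonneg (x := ξ) (s := frontier Ω))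
  have hs := Real.sqrt_nonneg (Metric.infDist ξ (frontier Ω))
  have h3 : √(Metric.infDist η (frontier Ω)) ≤ √(Metric.infDist ξ (frontier Ω)) + t / 2 := by
    refine Real.sqrt_le_iff.2 ⟨by positivity, h2.trans ?_⟩
    nlinarith [mul_nonneg hs ht]
  linarith

theorem le_measureReal_Uball_near {κ : ℝ} (hT : HasTangentBalls Ω ν κ)
    (hκ : 0 < κ) (hc : IsCompact (frontier Ω)) (hne : (frontier Ω).Nonempty) (hξΩ : ξ ∈ Ω) {t : ℝ}
    (ht : 0 < t) (htκ : t ≤ κ / 16) (hξ : Metric.infDist ξ (frontier Ω) ≤ κ / 16)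
    (hst : √(Metric.infDist ξ (frontier Ω)) + t ≤ 1) :
    (1 / 64) ^ d / 4 * volume.real (Metric.ball (0 : EuclideanSpace ℝ (Fin d)) 1) *
        (t ^ d * (√(Metric.infDist ξ (frontier Ω)) + t)) ≤ volume.real (Uball Ω ξ t) := by
  obtain ⟨p, hp, hξp⟩ := hc.exists_infDist_eq_dist hne ξ
  have hνp := (hT p hp).1
  have hmemU := fun η => mem_Uball_of_infDist_mem_Icc (Ω := Ω) (ξ := ξ) (η := η) ht.le
  have hs := Real.sqrt_nonneg (Metric.infDist ξ (frontier Ω))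
  set s := √(Metric.infDist ξ (frontier Ω)) with hsd
  set w := t * (s + t) / 4 with hw
  have hw0 : 0 < w := by positivity
  have hwt : w ≤ t / 4 := by
    have : t * (s + t) ≤ t * 1 := by gcongr
    linarith
  set K := ⌈5 / 32 * t / w⌉₊ with hK
  have hKle : 5 / 32 * t ≤ K * w := by
    have := Nat.le_ceil (5 / 32 * t / w)
    rwa [div_le_iff₀ hw0] at this
  have hKlt : K * w ≤ 5 / 32 * t + w := by
    have := (Nat.ceil_lt_add_one (show 0 ≤ 5 / 32 * t / w by positivity)).le
    rw [← hK] at this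
    calc K * w ≤ (5 / 32 * t / w + 1) * w := by gcongr
      _ = _ := by field_simp
  have hstart := hT.infDist_sub_smul_ge hκ hc hp hξΩ (by rw [← hξp]; linarith)
    (h := t / 16) (by positivity) (by linarith)
  set ξ' := ξ - (t / 16) • ν p with hξ'
  have hξξ' : dist ξ' ξ = t / 16 := by
    rw [dist_eq_norm, hξ', sub_sub_cancel_left, norm_neg, norm_smul, hνp, mul_one,
      Real.norm_of_nonneg (by positivity)]
  have hcov : volume.real (Metric.ball ξ' (t / 64)) ≤
      (K + 1 : ℕ) * volume.real (Uball Ω ξ t) := by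
    refine measureReal_le_nat_mul_of_translates (measure_Uball_ne_top Ω ξ t) (w • ν p) (K + 1) ?_
    intro y hy
    rw [Metric.mem_ball] at hy
    have hyΩ : y ∈ Ω := mem_of_dist_lt_infDist_frontier hstart.1 (by
      linarith [hstart.2, Metric.infDist_nonneg (x := ξ) (s := frontier Ω)])
    have hyξ : dist y ξ ≤ 5 / 64 * t := by linarith [dist_triangle y ξ' ξ]
    have hyle := Metric.infDist_le_infDist_add_dist (s := frontier Ω) (x := y) (y := ξ)
    have hyge := Metric.infDist_le_infDist_add_dist (s := frontier Ω) (x := ξ') (y := y)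
    rw [dist_comm] at hyge
    have hdist : ∀ k ≤ K, dist (y + (k : ℝ) • w • ν p) ξ ≤ t / 2 := by
      intro k hk
      have h1 : dist (y + (k : ℝ) • w • ν p) y = k * w := by
        rw [dist_eq_norm, add_sub_cancel_left, smul_smul, norm_smul, hνp, mul_one,
          Real.norm_of_nonneg (by positivity)]
      have h2 : (k : ℝ) * w ≤ K * w := by gcongr
      linarith [dist_triangle (y + (k : ℝ) • w • ν p) y ξ]
    have hind : ∀ k ≤ K, (∃ j < k + 1, y + (j : ℝ) • w • ν p ∈ Uball Ω ξ t) ∨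
        (y + (k : ℝ) • w • ν p ∈ Ω ∧
          Metric.infDist ξ (frontier Ω) + w <
            Metric.infDist (y + (k : ℝ) • w • ν p) (frontier Ω) ∧
          Metric.infDist (y + (k : ℝ) • w • ν p) (frontier Ω) + k * w / 2 ≤
            Metric.infDist y (frontier Ω)) := by
      intro k
      induction k with
      | zero =>
        intro _
        by_cases hle : Metric.infDist y (frontier Ω) ≤ Metric.infDist ξ (frontier Ω) + w
        · refine Or.inl ⟨0, by omega, ?_⟩
          simp only [Nat.cast_zero, zero_smul, add_zero]
          exact hmemU y hyΩ (by linarith) (by linarith [hstart.2]) hle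
        · right
          simpa [hyΩ] using hle
      | succ k ih =>
        intro hk
        rcases ih (by omega) with ⟨j, hj, hjU⟩ | ⟨hΩk, hgt, hle⟩
        · exact Or.inl ⟨j, by omega, hjU⟩
        have hd1 := hdist (k + 1) hk
        have hstep : y + (k : ℝ) • w • ν p =
            y + ((k + 1 : ℕ) : ℝ) • w • ν p - w • ν p := by
          push_cast; module
        set a := y + (k : ℝ) • w • ν p
        set b := y + ((k + 1 : ℕ) : ℝ) • w • ν p with hb
        have hab : dist b a = w := by
          rw [hstep, dist_eq_norm, sub_sub_cancel, norm_smul, hνp, mul_one,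
            Real.norm_of_nonneg hw0.le]
        have hξ0 := Metric.infDist_nonneg (x := ξ) (s := frontier Ω)
        have hbΩ : b ∈ Ω := mem_of_dist_lt_infDist_frontier hΩk (by linarith)
        have hbp : dist b p ≤ κ / 8 := by linarith [dist_triangle b ξ p]
        have hmono := (hT.infDist_sub_smul_ge hκ hc hp hbΩ hbp hw0.le (by linarith)).2
        rw [← hstep] at hmono
        have hlip := Metric.infDist_le_infDist_add_dist (s := frontier Ω) (x := a) (y := b)
        rw [dist_comm] at hlip
        by_cases hle' : Metric.infDist b (frontier Ω) ≤ Metric.infDist ξ (frontier Ω) + w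
        · exact Or.inl ⟨k + 1, by omega, hmemU b hbΩ hd1 (by linarith) hle'⟩
        · refine Or.inr ⟨hbΩ, not_le.1 hle', ?_⟩
          push_cast
          linarith
    rcases hind K le_rfl with h | ⟨-, h1, h2⟩
    · exact h
    · linarith
  rw [measureReal_ball_eq ξ' (by positivity)] at hcov
  have hN : ((K + 1 : ℕ) : ℝ) ≤ 4 / (s + t) := by
    have h1 : ((K + 1 : ℕ) : ℝ) * w ≤ t := by push_cast; linarith
    rw [le_div_iff₀ (by positivity)]
    refine le_of_mul_le_mul_right ?_ ht
    calc ((K + 1 : ℕ) : ℝ) * (s + t) * t = 4 * (((K + 1 : ℕ) : ℝ) * w) := by rw [hw]; ring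
      _ ≤ 4 * t := by gcongr
  have h6 := hcov.trans (mul_le_mul_of_nonneg_right hN measureReal_nonneg)
  rw [div_mul_eq_mul_div, le_div_iff₀ (by positivity)] at h6
  have h7 : (t / 64) ^ d = (1 / 64) ^ d * t ^ d := by rw [← mul_pow]; ring
  rw [h7] at h6
  linarith

theorem exists_measureReal_Uball_le (hΩ : IsClosed Ω) {κ : ℝ} (hT : HasTangentBalls Ω ν κ)
    (hκ : 0 < κ) (hc : IsCompact (frontier Ω)) (hne : (frontier Ω).Nonempty) :
    ∃ C : ℝ, ∀ ξ ∈ Ω, ∀ t : ℝ, 0 < t → volume.real (Uball Ω ξ t) ≤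
      C * (t ^ d * (√(Metric.infDist ξ (frontier Ω)) + t)) := by
  set ω := volume.real (Metric.ball (0 : EuclideanSpace ℝ (Fin d)) 1)
  set r := min (κ / 16) √(κ / 16)
  have hr : 0 < r := by positivity
  refine ⟨max (16 * 2 ^ d * ω) (r⁻¹ * ω), fun ξ _ t ht => ?_⟩
  have hX : 0 ≤ t ^ d * (√(Metric.infDist ξ (frontier Ω)) + t) := by positivity
  by_cases h : t ≤ κ / 16 ∧ Metric.infDist ξ (frontier Ω) ≤ κ / 16
  · exact (measureReal_Uball_le_near hΩ hT hκ hc hne ht h.1 h.2).trans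
      (mul_le_mul_of_nonneg_right (le_max_left _ _) hX)
  · refine (measureReal_Uball_le_far ht.le hr ?_).trans
      (mul_le_mul_of_nonneg_right (le_max_right _ _) hX)
    have hs := Real.sqrt_nonneg (Metric.infDist ξ (frontier Ω))
    rcases not_and_or.1 h with h | h
    · linarith [min_le_left (κ / 16) √(κ / 16)]
    · linarith [min_le_right (κ / 16) √(κ / 16), Real.sqrt_le_sqrt (not_le.1 h).le]

theorem exists_le_measureReal_Uball (hΩ : IsCompact Ω) {κ : ℝ} (hT : HasTangentBalls Ω ν κ)
    (hκ : 0 < κ) (hc : IsCompact (frontier Ω)) (hne : (frontier Ω).Nonempty) :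
    ∃ C : ℝ, 0 < C ∧ ∀ ξ ∈ Ω, ∀ t : ℝ, 0 < t → t < 1 →
      C * (t ^ d * (√(Metric.infDist ξ (frontier Ω)) + t)) ≤ volume.real (Uball Ω ξ t) := by
  set ω := volume.real (Metric.ball (0 : EuclideanSpace ℝ (Fin d)) 1) with hω
  have hω0 : 0 < ω :=
    ENNReal.toReal_pos (Metric.measure_ball_pos _ _ one_pos).ne' measure_ball_lt_top.ne
  obtain ⟨D, hD⟩ := (hΩ.image (Metric.continuous_infDist_pt (frontier Ω))).bddAbove
  set S := √D + 1
  have hS : 0 < S := by positivity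
  set m := min (κ / 16) (1 / 4) with hm
  have hm0 : 0 < m := by positivity
  have hmκ : m ≤ κ / 16 := min_le_left _ _
  have hm4 : m ≤ 1 / 4 := min_le_right _ _
  set C₀ := min ((1 / 64) ^ d / 4 * ω) ((m / 2) ^ d * S⁻¹ * ω) with hC₀
  have hC₀0 : 0 < C₀ := by positivity
  have hsmall : ∀ ξ ∈ Ω, ∀ t : ℝ, 0 < t → t ≤ m →
      C₀ * (t ^ d * (√(Metric.infDist ξ (frontier Ω)) + t)) ≤ volume.real (Uball Ω ξ t) := by
    intro ξ hξ t ht htm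
    have hX : 0 ≤ t ^ d * (√(Metric.infDist ξ (frontier Ω)) + t) := by positivity
    have e := Real.sq_sqrt (Metric.infDist_nonneg (x := ξ) (s := frontier Ω))
    have hs := Real.sqrt_nonneg (Metric.infDist ξ (frontier Ω))
    rcases le_total m √(Metric.infDist ξ (frontier Ω)) with h | h
    · refine (mul_le_mul_of_nonneg_right (min_le_right _ _) hX).trans
        (le_measureReal_Uball_far hξ ht hm0 (by linarith) htm h ?_)
      have := Real.sqrt_le_sqrt (hD (mem_image_of_mem _ hξ))
      linarith
    · refine (mul_le_mul_of_nonneg_right (min_le_left _ _) hX).trans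
        (le_measureReal_Uball_near hT hκ hc hne hξ ht (htm.trans hmκ) ?_ (by linarith))
      nlinarith
  refine ⟨C₀ * m ^ (d + 1), by positivity, fun ξ hξ t ht ht1 => ?_⟩
  have hs := Real.sqrt_nonneg (Metric.infDist ξ (frontier Ω))
  have hmt : m * t ≤ t := mul_le_of_le_one_left ht.le (by linarith)
  have h1 := hsmall ξ hξ (m * t) (by positivity) (mul_le_of_le_one_right hm0.le ht1.le)
  refine le_trans ?_ (h1.trans (measureReal_mono (Uball_mono Ω ξ hmt)
    (measure_Uball_ne_top Ω ξ t)))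
  set s := √(Metric.infDist ξ (frontier Ω))
  have hms : m * s ≤ s := mul_le_of_le_one_left hs (by linarith)
  calc C₀ * m ^ (d + 1) * (t ^ d * (s + t)) = C₀ * ((m * t) ^ d * (m * s + m * t)) := by ring
    _ ≤ C₀ * ((m * t) ^ d * (s + m * t)) := by gcongr

end Uball

/-- **Corollary 3.4(i)**: `|U(ξ,t)| ∼ t^d (√dist(ξ,∂Ω) + t)` for `ξ ∈ Ω`, `0 < t < 1`. -/
theorem measure_Uball_asymp {d : ℕ} (hd : 2 ≤ d)
    (Ω : Set (EuclideanSpace ℝ (Fin d)))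
    (ν : EuclideanSpace ℝ (Fin d) → EuclideanSpace ℝ (Fin d))
    (hΩ : IsCompactC2Domain Ω ν) :
    ∃ c : ℝ, 1 ≤ c ∧ ∀ ξ ∈ Ω, ∀ t : ℝ, 0 < t → t < 1 →
      c⁻¹ * (t ^ d * (Real.sqrt (Metric.infDist ξ (frontier Ω)) + t)) ≤
          (volume (Uball Ω ξ t)).toReal ∧
        (volume (Uball Ω ξ t)).toReal ≤
          c * (t ^ d * (Real.sqrt (Metric.infDist ξ (frontier Ω)) + t)) := by
  obtain ⟨hcpt, κ, hκ, -, -, -, -, -, hT⟩ := hΩ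
  replace hT : HasTangentBalls Ω ν κ := hT
  rcases Ω.eq_empty_or_nonempty with rfl | hΩne
  · exact ⟨1, le_rfl, fun ξ hξ => absurd hξ (notMem_empty ξ)⟩
  have : Nontrivial (Fin d) := Fin.nontrivial_iff_two_le.2 hd
  have hne : (frontier Ω).Nonempty :=
    nonempty_frontier_iff.2 ⟨hΩne, fun h => noncompact_univ _ (h ▸ hcpt)⟩
  have hc : IsCompact (frontier Ω) :=
    hcpt.of_isClosed_subset isClosed_frontier hcpt.isClosed.frontier_subset
  obtain ⟨C, hC⟩ := exists_measureReal_Uball_le hcpt.isClosed hT hκ hc hne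
  obtain ⟨C', hC'0, hC'⟩ := exists_le_measureReal_Uball hcpt hT hκ hc hne
  refine ⟨max 1 (max C C'⁻¹), le_max_left _ _, fun ξ hξ t ht ht1 => ⟨?_, ?_⟩⟩
  · refine le_trans (mul_le_mul_of_nonneg_right ?_ (by positivity)) (hC' ξ hξ t ht ht1)
    exact inv_le_of_inv_le₀ hC'0 ((le_max_right _ _).trans (le_max_right _ _))
  · refine (hC ξ hξ t ht).trans (mul_le_mul_of_nonneg_right ?_ (by positivity))
    exact (le_max_left _ _).trans (le_max_right _ _)
end
end

section
/- Let Ω ⊆ ℝ^d be a compact C²-domain. There exists a constant C > 1 depending only on Ω such that for every ξ ∈ Ω, every δ > 0 and every L > 1, there exist m ≤ C L^d points ξ_1,…,ξ_m ∈ U(ξ, Lδ) with U(ξ, Lδ) ⊆ ∪_{j=1}^m U(ξ_j, δ). -/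
open MeasureTheory Set
open scoped ENNReal

noncomputable section

/-- A finite family of points of a ball of radius `R` in a `d`-dimensional Euclidean space which is
`s`-separated has at most `(1 + 2R/s)^d` members. -/
lemma card_le_of_separated_of_mem_closedBall {ι : Type*} {d : ℕ} (hd : 0 < d) (T : Finset ι)
    (F : ι → EuclideanSpace ℝ (Fin d)) (x : EuclideanSpace ℝ (Fin d)) {R s : ℝ} (hs : 0 < s)
    (hR : 0 ≤ R)
    (hsep : ∀ a ∈ T, ∀ b ∈ T, a ≠ b → s ≤ dist (F a) (F b))
    (hball : ∀ a ∈ T, dist (F a) x ≤ R) :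
    (T.card : ℝ) ≤ (1 + 2 * R / s) ^ d := by
  have : Nonempty (Fin d) := ⟨⟨0, hd⟩⟩
  let μ : Measure (EuclideanSpace ℝ (Fin d)) := volume
  have hdisj : (T : Set ι).PairwiseDisjoint (fun a => Metric.ball (F a) (s / 2)) := by
    intro a ha b hb hab
    apply Metric.ball_disjoint_ball
    have := hsep a ha b hb hab
    linarith
  have hsub : (⋃ a ∈ T, Metric.ball (F a) (s / 2)) ⊆ Metric.ball x (R + s / 2) := by
    intro y hy
    simp only [mem_iUnion, Metric.mem_ball] at hy ⊢
    obtain ⟨a, ha, hya⟩ := hy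
    have := hball a ha
    linarith [dist_triangle y (F a) x]
  have h1 := measure_mono (μ := μ) hsub
  rw [measure_biUnion_finset hdisj (fun a _ => Metric.isOpen_ball.measurableSet)] at h1
  have hd' : Module.finrank ℝ (EuclideanSpace ℝ (Fin d)) = d := by simp
  have hs2 : 0 < s / 2 := by linarith
  have hRs : 0 < R + s / 2 := by linarith
  simp only [Measure.addHaar_ball_of_pos μ _ hs2, Measure.addHaar_ball_of_pos μ _ hRs, hd',
    Finset.sum_const, nsmul_eq_mul, ← mul_assoc] at h1
  rw [ENNReal.mul_le_mul_iff_left (Metric.measure_ball_pos μ 0 one_pos).ne'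
    measure_ball_lt_top.ne, ← ENNReal.ofReal_natCast, ← ENNReal.ofReal_mul (by positivity),
    ENNReal.ofReal_le_ofReal_iff (by positivity)] at h1
  have h2 : 1 + 2 * R / s = (R + s / 2) / (s / 2) := by
    field_simp
    ring
  rw [h2, div_pow, le_div_iff₀ (by positivity)]
  exact h1

section Domain

variable {d : ℕ} {Ω : Set (EuclideanSpace ℝ (Fin d))}

lemma rhoMetric_self (x : EuclideanSpace ℝ (Fin d)) : rhoMetric Ω x x = 0 := by
  simp [rhoMetric]

lemma rhoMetric_comm (x y : EuclideanSpace ℝ (Fin d)) : rhoMetric Ω x y = rhoMetric Ω y x := by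
  simp only [rhoMetric, dist_comm x y, abs_sub_comm (√(Metric.infDist x (frontier Ω)))]

lemma rhoMetric_triangle (x y z : EuclideanSpace ℝ (Fin d)) :
    rhoMetric Ω x z ≤ rhoMetric Ω x y + rhoMetric Ω y z := by
  simp only [rhoMetric]
  linarith [dist_triangle x y z, abs_sub_le (√(Metric.infDist x (frontier Ω)))
    (√(Metric.infDist y (frontier Ω))) (√(Metric.infDist z (frontier Ω)))]

/-- The boundary distance of a point of `Ω` is at most its distance to an exterior ball. -/
lemma infDist_frontier_le_of_ball_subset_compl (hΩ : IsClosed Ω)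
    {c x : EuclideanSpace ℝ (Fin d)} {κ : ℝ} (hκ : 0 < κ) (hc : Metric.ball c κ ⊆ Ωᶜ)
    (hx : x ∈ Ω) : Metric.infDist x (frontier Ω) ≤ dist x c - κ := by
  obtain ⟨y, hy, hyf⟩ : (segment ℝ x c ∩ frontier Ω).Nonempty := by
    by_contra hempty
    have hint : ∀ z ∈ segment ℝ x c, z ∈ Ω → z ∈ interior Ω := fun z hz hzΩ => by
      by_contra hzi
      exact hempty ⟨z, hz, subset_closure hzΩ, hzi⟩
    obtain ⟨z, -, hz1, hz2⟩ := (convex_segment (𝕜 := ℝ) x c).isPreconnected (interior Ω) Ωᶜ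
      isOpen_interior hΩ.isOpen_compl (fun z hz => (em (z ∈ Ω)).imp_left (hint z hz))
      ⟨x, left_mem_segment ℝ x c, hint x (left_mem_segment ℝ x c) hx⟩
      ⟨c, right_mem_segment ℝ x c, hc (Metric.mem_ball_self hκ)⟩
    exact hz2 (interior_subset hz1)
  have h1 := dist_add_dist_of_mem_segment hy
  have h2 : κ ≤ dist y c := by
    by_contra! h
    exact hc h (hΩ.frontier_subset hyf)
  linarith [Metric.infDist_le_dist_of_mem (x := x) hyf]

/-- Two-sided tangent balls of radius `κ` force the normal to be Hölder continuous. -/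
lemma norm_normal_sub_sq_le {p q m n : EuclideanSpace ℝ (Fin d)} {κ : ℝ} (hκ : 0 < κ)
    (hm : ‖m‖ = 1) (hn : ‖n‖ = 1)
    (hp : Metric.ball (p - κ • m) κ ⊆ Ω) (hq : Metric.ball (q + κ • n) κ ⊆ Ωᶜ) :
    κ * ‖m - n‖ ^ 2 ≤ 4 * dist p q := by
  have h1 : 2 * κ ≤ dist (p - κ • m) (q + κ • n) := by
    by_contra! h
    set a := p - κ • m
    set b := q + κ • n
    have ha : midpoint ℝ a b ∈ Metric.ball a κ := by
      rw [Metric.mem_ball, dist_midpoint_left]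
      norm_num
      linarith
    have hb : midpoint ℝ a b ∈ Metric.ball b κ := by
      rw [Metric.mem_ball, dist_midpoint_right]
      norm_num
      linarith
    exact hq hb (hp ha)
  have h2 : dist (p - κ • m) (q + κ • n) ≤ dist p q + κ * ‖m + n‖ := by
    rw [dist_eq_norm, dist_eq_norm,
      show p - κ • m - (q + κ • n) = (p - q) - κ • (m + n) by rw [smul_add]; abel]
    refine (norm_sub_le _ _).trans ?_
    rw [norm_smul, Real.norm_of_nonneg hκ.le]
  have h3 := parallelogram_law_with_norm ℝ m n
  have h4 : ‖m + n‖ ≤ 2 := (norm_add_le _ _).trans (by rw [hm, hn]; norm_num)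
  have h5 := norm_nonneg (m + n)
  rw [hm, hn] at h3
  nlinarith [mul_nonneg h5 (sub_nonneg.2 h4), dist_nonneg (x := p) (y := q)]

/-- Convexity estimate for the norm, at a vector close to `-κ • n`. -/
lemma norm_sub_norm_le_of_near {a b n : EuclideanSpace ℝ (Fin d)} {κ : ℝ} (hκ : 0 < κ)
    (hn : ‖n‖ = 1) (hb : ‖b + κ • n‖ ≤ κ / 4) :
    ‖b‖ - ‖a‖ ≤ -inner ℝ (b - a) n + 1 / 2 * ‖b - a‖ := by
  have hκn : ‖κ • n‖ = κ := by rw [norm_smul, hn, Real.norm_of_nonneg hκ.le, mul_one]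
  have h1 : |‖b‖ - κ| ≤ κ / 4 := by
    have := abs_norm_sub_norm_le b (-(κ • n))
    rw [norm_neg, hκn, sub_neg_eq_add] at this
    exact this.trans hb
  have hb0 : 0 < ‖b‖ := by linarith [(abs_le.1 h1).1]
  set u := ‖b‖⁻¹ • b with hu
  have hu1 : ‖u‖ = 1 := by rw [hu, norm_smul, norm_inv, norm_norm, inv_mul_cancel₀ hb0.ne']
  have hub : b = ‖b‖ • u := by rw [hu, smul_smul, mul_inv_cancel₀ hb0.ne', one_smul]
  have h2 : κ * ‖u + n‖ ≤ κ / 2 := by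
    have h3 : κ • (u + n) = (b + κ • n) - (‖b‖ - κ) • u := by
      rw [smul_add, sub_smul, ← hub]
      abel
    calc κ * ‖u + n‖ = ‖κ • (u + n)‖ := by rw [norm_smul, Real.norm_of_nonneg hκ.le]
      _ ≤ ‖b + κ • n‖ + ‖(‖b‖ - κ) • u‖ := by rw [h3]; exact norm_sub_le _ _
      _ ≤ κ / 2 := by
        rw [norm_smul, hu1, mul_one, Real.norm_eq_abs]
        linarith
  have h4 : ‖u + n‖ ≤ 1 / 2 := by
    by_contra! h
    nlinarith
  have h5 : inner ℝ b u = ‖b‖ := by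
    rw [hu, inner_smul_right, real_inner_self_eq_norm_sq]
    field_simp
  have h6 : inner ℝ a u ≤ ‖a‖ := by simpa [hu1] using real_inner_le_norm a u
  have h7 : inner ℝ (b - a) (u + n) ≤ ‖b - a‖ * (1 / 2) :=
    (real_inner_le_norm _ _).trans (by gcongr)
  rw [inner_add_right, inner_sub_left b a u] at h7
  linarith

/-- Near a boundary point `p`, the boundary distance decreases in the direction of the outer normal
`ν p`, up to a Lipschitz error of constant `1/2`. -/
lemma infDist_frontier_sub_le (hΩ : IsClosed Ω)
    {ν : EuclideanSpace ℝ (Fin d) → EuclideanSpace ℝ (Fin d)} {κ : ℝ} (hκ : 0 < κ)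
    (hν : ∀ ξ ∈ frontier Ω, ‖ν ξ‖ = 1 ∧ Metric.ball (ξ - κ • ν ξ) κ ⊆ Ω ∧
      Metric.ball (ξ + κ • ν ξ) κ ⊆ Ωᶜ)
    {p x y : EuclideanSpace ℝ (Fin d)} (hp : p ∈ frontier Ω) (hx : x ∈ Ω)
    (hxp : dist x p ≤ κ / 800) (hyp : dist y p ≤ κ / 800) :
    Metric.infDist x (frontier Ω) - Metric.infDist y (frontier Ω) ≤
      -inner ℝ (x - y) (ν p) + 1 / 2 * dist x y := by
  obtain ⟨q, hq, hqd⟩ := isClosed_frontier.exists_infDist_eq_dist ⟨p, hp⟩ y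
  obtain ⟨hp1, hp2, -⟩ := hν p hp
  obtain ⟨hq1, -, hq3⟩ := hν q hq
  have hyq : dist y q ≤ κ / 800 := hqd ▸ (Metric.infDist_le_dist_of_mem hp).trans hyp
  have hpq : dist p q ≤ κ / 400 := by
    linarith [dist_triangle p y q, dist_comm p y]
  have hxq : dist x q ≤ 3 * κ / 800 := by linarith [dist_triangle x p q]
  have hnn : ‖ν p - ν q‖ ≤ 1 / 10 := by
    have h := norm_normal_sub_sq_le hκ hp1 hq1 hp2 hq3
    have h' : ‖ν p - ν q‖ ^ 2 ≤ (1 / 10) ^ 2 := by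
      by_contra! hlt
      nlinarith
    exact le_of_sq_le_sq h' (by norm_num)
  have h1 := infDist_frontier_le_of_ball_subset_compl hΩ hκ hq3 hx
  have h2 : dist y (q + κ • ν q) ≤ Metric.infDist y (frontier Ω) + κ := by
    rw [hqd]
    refine (dist_triangle y q _).trans ?_
    simp [norm_smul, hq1, abs_of_pos hκ]
  have h3 : ‖(x - (q + κ • ν q)) + κ • ν p‖ ≤ κ / 4 := by
    rw [show (x - (q + κ • ν q)) + κ • ν p = (x - q) + κ • (ν p - ν q) by rw [smul_sub]; abel]
    refine (norm_add_le _ _).trans ?_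
    rw [norm_smul, Real.norm_of_nonneg hκ.le, ← dist_eq_norm]
    nlinarith
  have h4 := norm_sub_norm_le_of_near (a := y - (q + κ • ν q)) hκ hp1 h3
  rw [sub_sub_sub_cancel_right, ← dist_eq_norm, ← dist_eq_norm, ← dist_eq_norm] at h4
  linarith

/-- Near each boundary point, `ρ_Ω` is bi-Lipschitz equivalent to a subset of Euclidean space, via
the map replacing the normal coordinate by the square root of the boundary distance. -/
lemma exists_biLipschitz_near_frontier (hΩ : IsClosed Ω)
    {ν : EuclideanSpace ℝ (Fin d) → EuclideanSpace ℝ (Fin d)} {κ : ℝ} (hκ : 0 < κ)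
    (hν : ∀ ξ ∈ frontier Ω, ‖ν ξ‖ = 1 ∧ Metric.ball (ξ - κ • ν ξ) κ ⊆ Ω ∧
      Metric.ball (ξ + κ • ν ξ) κ ⊆ Ωᶜ)
    {p : EuclideanSpace ℝ (Fin d)} (hp : p ∈ frontier Ω) :
    ∃ (F : EuclideanSpace ℝ (Fin d) → EuclideanSpace ℝ (Fin d)) (A : ℝ), 0 < A ∧
      ∀ x ∈ Ω ∩ Metric.closedBall p (κ / 800), ∀ y ∈ Ω ∩ Metric.closedBall p (κ / 800),
        dist (F x) (F y) ≤ 2 * rhoMetric Ω x y ∧ rhoMetric Ω x y ≤ A * dist (F x) (F y) := by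
  set n := ν p
  have hn1 : ‖n‖ = 1 := (hν p hp).1
  set g : EuclideanSpace ℝ (Fin d) → ℝ := fun x => Metric.infDist x (frontier Ω)
  set M := √(κ / 800)
  refine ⟨fun x => x + (√(g x) - inner ℝ x n) • n, 5 + 4 * M, by positivity, ?_⟩
  rintro x ⟨hx, hxp⟩ y ⟨hy, hyp⟩
  rw [Metric.mem_closedBall] at hxp hyp
  have hxy := infDist_frontier_sub_le hΩ hκ hν hp hx hxp hyp
  have hyx := infDist_frontier_sub_le hΩ hκ hν hp hy hyp hxp
  have hgM : ∀ z, dist z p ≤ κ / 800 → √(g z) ≤ M := fun z hz =>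
    Real.sqrt_le_sqrt ((Metric.infDist_le_dist_of_mem hp).trans hz)
  have hxM := hgM x hxp
  have hyM := hgM y hyp
  have hx2 : √(g x) ^ 2 = g x := Real.sq_sqrt Metric.infDist_nonneg
  have hy2 : √(g y) ^ 2 = g y := Real.sq_sqrt Metric.infDist_nonneg
  have hx0 := Real.sqrt_nonneg (g x)
  have hy0 := Real.sqrt_nonneg (g y)
  have hρ : rhoMetric Ω x y = dist x y + |√(g x) - √(g y)| := rfl
  have hgx : Metric.infDist x (frontier Ω) = g x := rfl
  have hgy : Metric.infDist y (frontier Ω) = g y := rfl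
  rw [hρ]
  rw [← neg_sub x y, inner_neg_left, dist_comm y x] at hyx
  rw [hgx, hgy] at hxy hyx
  have hF : dist (x + (√(g x) - inner ℝ x n) • n) (y + (√(g y) - inner ℝ y n) • n) =
      ‖(x - y) + ((√(g x) - √(g y)) - inner ℝ (x - y) n) • n‖ := by
    rw [dist_eq_norm, inner_sub_left]
    congr 1
    module
  simp only [hF]
  rw [dist_eq_norm] at hxy hyx ⊢
  set h := x - y
  set s := √(g x) - √(g y)
  set i : ℝ := inner ℝ h n
  set v := h + (s - i) • n with hv
  have hi : |i| ≤ ‖h‖ := by simpa [hn1] using abs_real_inner_le_norm h n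
  have hvn : inner ℝ v n = s := by
    rw [hv, inner_add_left, inner_smul_left, real_inner_self_eq_norm_sq, hn1]
    simp [i]
  have hsv : |s| ≤ ‖v‖ := by
    rw [← hvn]
    simpa [hn1] using abs_real_inner_le_norm v n
  have hdiff : |g x - g y| ≤ 2 * M * |s| := by
    rw [← hx2, ← hy2, sq_sub_sq, abs_mul, abs_of_nonneg (by positivity)]
    gcongr
    linarith
  have hi2 : |i| ≤ 1 / 2 * ‖h‖ + |g x - g y| := by
    rw [abs_le]
    constructor <;> linarith [le_abs_self (g x - g y), neg_abs_le (g x - g y)]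
  constructor
  · calc ‖v‖ ≤ ‖h‖ + |s - i| := by
          refine (norm_add_le _ _).trans ?_
          rw [norm_smul, hn1, mul_one, Real.norm_eq_abs]
      _ ≤ 2 * (‖h‖ + |s|) := by linarith [abs_sub s i, abs_nonneg s]
  · have hh : ‖h‖ ≤ ‖v‖ + (|s| + |i|) := by
      rw [show h = v - (s - i) • n by rw [hv]; abel]
      refine (norm_sub_le _ _).trans ?_
      rw [norm_smul, hn1, mul_one, Real.norm_eq_abs]
      linarith [abs_sub s i]
    have hM : M * |s| ≤ M * ‖v‖ := by gcongr
    linarith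

/-- Around each point, the metric `ρ_Ω` on `Ω` is bi-Lipschitz equivalent to a subset of
Euclidean space. -/
lemma exists_nhdsWithin_biLipschitz (hΩ : IsClosed Ω)
    {ν : EuclideanSpace ℝ (Fin d) → EuclideanSpace ℝ (Fin d)} {κ : ℝ} (hκ : 0 < κ)
    (hν : ∀ ξ ∈ frontier Ω, ‖ν ξ‖ = 1 ∧ Metric.ball (ξ - κ • ν ξ) κ ⊆ Ω ∧
      Metric.ball (ξ + κ • ν ξ) κ ⊆ Ωᶜ)
    (p : EuclideanSpace ℝ (Fin d)) :
    ∃ V ∈ nhdsWithin p Ω, ∃ (F : EuclideanSpace ℝ (Fin d) → EuclideanSpace ℝ (Fin d)) (A : ℝ),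
      0 < A ∧ ∀ x ∈ V, ∀ y ∈ V,
        dist (F x) (F y) ≤ 2 * rhoMetric Ω x y ∧ rhoMetric Ω x y ≤ A * dist (F x) (F y) := by
  have hle : ∀ x y, dist x y ≤ 2 * rhoMetric Ω x y := fun x y => by
    simp only [rhoMetric]
    linarith [dist_nonneg (x := x) (y := y), abs_nonneg (√(Metric.infDist x (frontier Ω)) -
      √(Metric.infDist y (frontier Ω)))]
  by_cases hpf : p ∈ frontier Ω
  · obtain ⟨F, A, hA, h⟩ := exists_biLipschitz_near_frontier hΩ hκ hν hpf
    exact ⟨_, inter_mem_nhdsWithin Ω (Metric.closedBall_mem_nhds p (by positivity)), F, A, hA, h⟩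
  rcases (frontier Ω).eq_empty_or_nonempty with he | hne
  · exact ⟨univ, Filter.univ_mem, id, 1, one_pos, fun x _ y _ =>
      ⟨hle x y, by simp [rhoMetric, he]⟩⟩
  set e := Metric.infDist p (frontier Ω) / 2 with he
  have he0 : 0 < e := half_pos ((isClosed_frontier.notMem_iff_infDist_pos hne).1 hpf)
  refine ⟨Metric.ball p e, mem_nhdsWithin_of_mem_nhds (Metric.ball_mem_nhds p he0), id,
    1 + 1 / √e, by positivity, fun x hx y hy => ⟨hle x y, ?_⟩⟩
  have hge : ∀ z ∈ Metric.ball p e, e ≤ Metric.infDist z (frontier Ω) := fun z hz => by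
    have := Metric.infDist_le_infDist_add_dist (s := frontier Ω) (x := p) (y := z)
    rw [Metric.mem_ball, dist_comm] at hz
    linarith
  have hlip : |Metric.infDist x (frontier Ω) - Metric.infDist y (frontier Ω)| ≤ dist x y := by
    rw [abs_le]
    constructor <;> linarith [Metric.infDist_le_infDist_add_dist (s := frontier Ω) (x := x) (y := y),
      Metric.infDist_le_infDist_add_dist (s := frontier Ω) (x := y) (y := x), dist_comm x y]
  simp only [rhoMetric, id]
  set a := Metric.infDist x (frontier Ω)
  set b := Metric.infDist y (frontier Ω)
  have hsa : √e ≤ √a := Real.sqrt_le_sqrt (hge x hx)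
  have hse : 0 < √e := Real.sqrt_pos.2 he0
  have hsq : |√a - √b| * (√a + √b) = |a - b| := by
    have hnn : |√a + √b| = √a + √b := abs_of_nonneg (by positivity)
    rw [← hnn, ← abs_mul, mul_comm, ← sq_sub_sq, Real.sq_sqrt Metric.infDist_nonneg,
      Real.sq_sqrt Metric.infDist_nonneg]
  have hfin : |√a - √b| ≤ dist x y / √e := by
    rw [le_div_iff₀ hse]
    refine le_trans ?_ hlip
    rw [← hsq]
    gcongr
    linarith [Real.sqrt_nonneg b]
  rw [add_mul, one_mul, one_div_mul_eq_div]
  linarith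

/-- Packing bound: a `δ`-separated finite subset of `Ω` of `ρ_Ω`-diameter at most `2Lδ` has at most
`C L^d` points. -/
lemma exists_card_le_of_rhoMetric_separated (hd : 0 < d) (hΩ : IsCompact Ω)
    {ν : EuclideanSpace ℝ (Fin d) → EuclideanSpace ℝ (Fin d)} {κ : ℝ} (hκ : 0 < κ)
    (hν : ∀ ξ ∈ frontier Ω, ‖ν ξ‖ = 1 ∧ Metric.ball (ξ - κ • ν ξ) κ ⊆ Ω ∧
      Metric.ball (ξ + κ • ν ξ) κ ⊆ Ωᶜ) :
    ∃ C : ℝ, ∀ δ L : ℝ, 0 < δ → 1 < L → ∀ T : Finset (EuclideanSpace ℝ (Fin d)),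
      (T : Set (EuclideanSpace ℝ (Fin d))) ⊆ Ω →
      (∀ x ∈ T, ∀ y ∈ T, x ≠ y → δ < rhoMetric Ω x y) →
      (∀ x ∈ T, ∀ y ∈ T, rhoMetric Ω x y ≤ 2 * (L * δ)) → (T.card : ℝ) ≤ C * L ^ d := by
  classical
  refine hΩ.induction_on (p := fun S => ∃ C : ℝ, ∀ δ L : ℝ, 0 < δ → 1 < L →
      ∀ T : Finset (EuclideanSpace ℝ (Fin d)), (T : Set (EuclideanSpace ℝ (Fin d))) ⊆ S →
      (∀ x ∈ T, ∀ y ∈ T, x ≠ y → δ < rhoMetric Ω x y) →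
      (∀ x ∈ T, ∀ y ∈ T, rhoMetric Ω x y ≤ 2 * (L * δ)) → (T.card : ℝ) ≤ C * L ^ d) ?_ ?_ ?_ ?_
  · refine ⟨0, fun δ L _ _ T hT _ _ => ?_⟩
    have : T = ∅ := by simpa [subset_empty_iff] using hT
    simp [this]
  · rintro s t hst ⟨C, hC⟩
    exact ⟨C, fun δ L hδ hL T hT => hC δ L hδ hL T (hT.trans hst)⟩
  · rintro s t ⟨C, hC⟩ ⟨D, hD⟩
    refine ⟨C + D, fun δ L hδ hL T hT h1 h2 => ?_⟩
    have hs := hC δ L hδ hL (T.filter (· ∈ s)) (fun x hx => by simp_all)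
      (fun x hx y hy => h1 x (Finset.mem_of_mem_filter x hx) y (Finset.mem_of_mem_filter y hy))
      (fun x hx y hy => h2 x (Finset.mem_of_mem_filter x hx) y (Finset.mem_of_mem_filter y hy))
    have ht := hD δ L hδ hL (T.filter (· ∉ s))
      (fun x hx => by
        rw [Finset.mem_coe, Finset.mem_filter] at hx
        exact (hT hx.1).resolve_left hx.2)
      (fun x hx y hy => h1 x (Finset.mem_of_mem_filter x hx) y (Finset.mem_of_mem_filter y hy))
      (fun x hx y hy => h2 x (Finset.mem_of_mem_filter x hx) y (Finset.mem_of_mem_filter y hy))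
    rw [← Finset.card_filter_add_card_filter_not (s := T) (· ∈ s)]
    push_cast
    linarith
  · intro p _
    obtain ⟨V, hV, F, A, hA, hF⟩ := exists_nhdsWithin_biLipschitz hΩ.isClosed hκ hν p
    refine ⟨V, hV, (1 + 8 * A) ^ d, fun δ L hδ hL T hT h1 h2 => ?_⟩
    rcases T.eq_empty_or_nonempty with rfl | ⟨t, ht⟩
    · simp only [Finset.card_empty, Nat.cast_zero]
      positivity
    have hL0 : 0 < L := by linarith
    have key := card_le_of_separated_of_mem_closedBall hd T F (F t) (R := 4 * (L * δ))
      (s := δ / A) (by positivity) (by positivity)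
      (fun a ha b hb hab => by
        rw [div_le_iff₀' hA]
        exact (h1 a ha b hb hab).le.trans (hF a (hT ha) b (hT hb)).2)
      (fun a ha => by
        linarith [(hF a (hT ha) t (hT ht)).1, h2 a ha t ht])
    refine key.trans ?_
    rw [← mul_pow]
    gcongr
    have : 2 * (4 * (L * δ)) / (δ / A) = 8 * A * L := by
      field_simp
      ring
    rw [this]
    linarith

end Domain

/-- **Corollary 3.4(ii)** (covering property): every ball `U(ξ, Lδ)` can be covered by at most
`C L^d` balls `U(ξ_j, δ)` with centers in `U(ξ, Lδ)`. -/
theorem Uball_covering {d : ℕ} (hd : 2 ≤ d)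
    (Ω : Set (EuclideanSpace ℝ (Fin d)))
    (ν : EuclideanSpace ℝ (Fin d) → EuclideanSpace ℝ (Fin d))
    (hΩ : IsCompactC2Domain Ω ν) :
    ∃ C : ℝ, 1 < C ∧ ∀ ξ ∈ Ω, ∀ δ L : ℝ, 0 < δ → 1 < L →
      ∃ (m : ℕ) (ζ : Fin m → EuclideanSpace ℝ (Fin d)),
        (m : ℝ) ≤ C * L ^ d ∧
        (∀ j, ζ j ∈ Uball Ω ξ (L * δ)) ∧
        Uball Ω ξ (L * δ) ⊆ ⋃ j, Uball Ω (ζ j) δ := by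
  classical
  obtain ⟨hcpt, κ, hκ, -, -, -, -, -, hν⟩ := hΩ
  obtain ⟨C, hC⟩ := exists_card_le_of_rhoMetric_separated (by omega) hcpt hκ hν
  refine ⟨max C 2, lt_max_of_lt_right one_lt_two, fun ξ _ δ L hδ hL => ?_⟩
  let P : Finset (EuclideanSpace ℝ (Fin d)) → Prop := fun T =>
    (∀ x ∈ T, x ∈ Uball Ω ξ (L * δ)) ∧ ∀ x ∈ T, ∀ y ∈ T, x ≠ y → δ < rhoMetric Ω x y
  have hcard : ∀ T, P T → (T.card : ℝ) ≤ C * L ^ d := fun T hT =>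
    hC δ L hδ hL T (fun x hx => (hT.1 x hx).1) hT.2 fun x hx y hy => by
      have h1 := (hT.1 x hx).2
      have h2 := (hT.1 y hy).2
      rw [rhoMetric_comm] at h1
      linarith [rhoMetric_triangle (Ω := Ω) x ξ y]
  let Q : ℕ → Prop := fun k => ∃ T, P T ∧ T.card = k
  have hQ : ∀ k, Q k → k ≤ ⌊C * L ^ d⌋₊ := by
    rintro _ ⟨T, hT, rfl⟩
    exact Nat.le_floor (hcard T hT)
  obtain ⟨T, hT, hTk⟩ : Q (Nat.findGreatest Q ⌊C * L ^ d⌋₊) :=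
    Nat.findGreatest_spec (Nat.zero_le _) ⟨∅, by simp [P], rfl⟩
  refine ⟨T.card, fun j => (T.equivFin.symm j : EuclideanSpace ℝ (Fin d)), ?_,
    fun j => hT.1 _ (T.equivFin.symm j).2, fun x hx => ?_⟩
  · refine (hcard T hT).trans ?_
    gcongr
    exact le_max_left _ _
  · by_contra hcov
    have hfar : ∀ t ∈ T, δ < rhoMetric Ω t x := fun t ht => by
      by_contra! h
      exact hcov (mem_iUnion.2 ⟨T.equivFin ⟨t, ht⟩, hx.1, by simpa using h⟩)
    have hxT : x ∉ T := fun h => by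
      have := hfar x h
      rw [rhoMetric_self] at this
      linarith
    have hins : P (insert x T) := by
      refine ⟨Finset.forall_mem_insert _ _ _ |>.2 ⟨hx, hT.1⟩, fun a ha b hb hab => ?_⟩
      rcases Finset.mem_insert.1 ha with rfl | ha' <;> rcases Finset.mem_insert.1 hb with rfl | hb'
      · exact absurd rfl hab
      · rw [rhoMetric_comm]
        exact hfar b hb'
      · exact hfar a ha'
      · exact hT.2 a ha' b hb' hab
    have hq : Q (T.card + 1) := ⟨insert x T, hins, Finset.card_insert_of_notMem hxT⟩
    have := Nat.le_findGreatest (hQ _ hq) hq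
    omega
end
end

section
/- Let Ω ⊆ ℝ^d be a compact C²-domain. There exists a constant C > 1 depending only on Ω such that for every δ ∈ (0,1) and every finite subset Λ ⊆ Ω that is δ-separated with respect to the metric ρ_Ω (i.e. ρ_Ω(ω, ω′) ≥ δ for all distinct ω, ω′ ∈ Λ), the cardinality of Λ satisfies #Λ ≤ C δ^{−d}. -/
open MeasureTheory Set
open scoped ENNReal

noncomputable section

open Metric

section Packing

/-- A finite `ε`-separated family in the closed ball of radius `R` in `ℝ^d` has at most
`((2 * R + ε) / ε) ^ d` elements. -/
lemma card_le_pow_of_separated {d : ℕ} {ι : Type*} (Λ : Finset ι)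
    (T : ι → EuclideanSpace ℝ (Fin d)) {R ε : ℝ} (hR : 0 ≤ R) (hε : 0 < ε)
    (hT : ∀ x ∈ Λ, ‖T x‖ ≤ R)
    (hsep : ∀ x ∈ Λ, ∀ y ∈ Λ, x ≠ y → ε ≤ dist (T x) (T y)) :
    (Λ.card : ℝ) ≤ ((2 * R + ε) / ε) ^ d := by
  have hdisj : (Λ : Set ι).PairwiseDisjoint fun x ↦ ball (T x) (ε / 2) := by
    intro x hx y hy hxy
    apply ball_disjoint_ball
    linarith [hsep x hx y hy hxy]
  have hsub : (⋃ x ∈ Λ, ball (T x) (ε / 2)) ⊆ ball 0 (R + ε / 2) := by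
    refine iUnion₂_subset fun x hx ↦ ball_subset_ball' ?_
    rw [dist_zero_right]
    linarith [hT x hx]
  have hvol := measure_mono (μ := volume) hsub
  rw [measure_biUnion_finset hdisj fun _ _ ↦ measurableSet_ball] at hvol
  simp only [Measure.addHaar_ball_of_pos volume _ (half_pos hε),
    Measure.addHaar_ball_of_pos volume _ (by positivity : 0 < R + ε / 2),
    Finset.sum_const, nsmul_eq_mul, finrank_euclideanSpace_fin, ← mul_assoc] at hvol
  have h0 : volume (ball (0 : EuclideanSpace ℝ (Fin d)) 1) ≠ 0 :=
    (measure_ball_pos _ _ one_pos).ne'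
  have hfin : volume (ball (0 : EuclideanSpace ℝ (Fin d)) 1) ≠ ∞ := measure_ball_lt_top.ne
  rw [ENNReal.mul_le_mul_iff_left h0 hfin, ← ENNReal.ofReal_natCast,
    ← ENNReal.ofReal_mul (by positivity), ENNReal.ofReal_le_ofReal_iff (by positivity)] at hvol
  have heq : (2 * R + ε) / ε = (R + ε / 2) / (ε / 2) := by
    field_simp
  rwa [heq, div_pow, le_div_iff₀ (by positivity)]

end Packing

section TwoSidedBall

variable {E : Type*} [NormedAddCommGroup E] [InnerProductSpace ℝ E]

/-- A ball inside `Ω` and a ball inside `Ωᶜ` have centers at least the sum of radii apart. -/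
lemma add_le_dist_of_ball_subset_compl {Ω : Set E} {a b : E} {r s : ℝ} (hr : 0 < r) (hs : 0 < s)
    (ha : ball a r ⊆ Ω) (hb : ball b s ⊆ Ωᶜ) : r + s ≤ dist a b := by
  rw [← disjoint_ball_ball_iff hr hs]
  exact disjoint_compl_right.mono ha hb

/-- A two-sided ball condition makes the normal field Lipschitz. -/
lemma norm_normal_sub_le {Ω : Set E} {ν : E → E} {κ : ℝ} (hκ : 0 < κ) {ξ η : E}
    (hξ : ‖ν ξ‖ = 1) (hη : ‖ν η‖ = 1)
    (hξi : ball (ξ - κ • ν ξ) κ ⊆ Ω) (hξe : ball (ξ + κ • ν ξ) κ ⊆ Ωᶜ)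
    (hηi : ball (η - κ • ν η) κ ⊆ Ω) (hηe : ball (η + κ • ν η) κ ⊆ Ωᶜ) :
    κ * ‖ν ξ - ν η‖ ≤ ‖ξ - η‖ := by
  have h1 := add_le_dist_of_ball_subset_compl hκ hκ hξi hηe
  have h2 := add_le_dist_of_ball_subset_compl hκ hκ hηi hξe
  rw [dist_eq_norm] at h1
  rw [dist_comm, dist_eq_norm] at h2
  rw [show ξ - κ • ν ξ - (η + κ • ν η) = (ξ - η) - κ • (ν ξ + ν η) by module] at h1
  rw [show ξ + κ • ν ξ - (η - κ • ν η) = (ξ - η) + κ • (ν ξ + ν η) by module] at h2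
  have h3 := parallelogram_law_with_norm ℝ (ξ - η) (κ • (ν ξ + ν η))
  have h4 := parallelogram_law_with_norm ℝ (ν ξ) (ν η)
  rw [norm_smul, Real.norm_of_nonneg hκ.le] at h3
  rw [hξ, hη] at h4
  have h1' := mul_self_le_mul_self (by positivity) h1
  have h2' := mul_self_le_mul_self (by positivity) h2
  apply abs_le_of_sq_le_sq' _ (norm_nonneg _) |>.2
  have h5 : κ ^ 2 * (‖ν ξ + ν η‖ ^ 2 + ‖ν ξ - ν η‖ ^ 2) = κ ^ 2 * 4 := by
    congr 1; linarith
  nlinarith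

/-- Under an interior ball condition at `ξ ∈ ∂Ω`, moving inwards by `s ≤ κ` along the normal gives
a point at distance `s` from `∂Ω`. -/
lemma infDist_sub_smul_normal {Ω : Set E} {ξ n : E} {κ s : ℝ} (hξ : ξ ∈ frontier Ω)
    (hn : ‖n‖ = 1) (hi : ball (ξ - κ • n) κ ⊆ Ω) (hs : 0 ≤ s) (hsκ : s ≤ κ) :
    infDist (ξ - s • n) (frontier Ω) = s := by
  apply le_antisymm
  · refine (infDist_le_dist_of_mem hξ).trans_eq ?_
    rw [dist_eq_norm, sub_sub_cancel_left, norm_neg, norm_smul, hn, Real.norm_of_nonneg hs,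
      mul_one]
  · rw [le_infDist ⟨ξ, hξ⟩]
    intro ζ hζ
    have hζ' : κ ≤ dist ζ (ξ - κ • n) := by
      by_contra! h
      exact hζ.2 (interior_maximal hi isOpen_ball h)
    have h2 : dist (ξ - s • n) (ξ - κ • n) = κ - s := by
      rw [dist_eq_norm, show ξ - s • n - (ξ - κ • n) = (κ - s) • n by module, norm_smul, hn,
        Real.norm_of_nonneg (sub_nonneg.2 hsκ), mul_one]
    have h3 := dist_triangle ζ (ξ - s • n) (ξ - κ • n)
    rw [dist_comm (ξ - s • n) ζ]
    linarith

/-- Under an exterior ball condition, a point of `Ω` lies on the inner normal through its nearest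
boundary point. -/
lemma eq_sub_infDist_smul_normal {Ω : Set E} {x ξ n : E} {κ : ℝ} (hκ : 0 < κ) (hx : x ∈ Ω)
    (hξx : infDist x (frontier Ω) = dist x ξ)
    (hn : ‖n‖ = 1) (he : ball (ξ + κ • n) κ ⊆ Ωᶜ) :
    x = ξ - infDist x (frontier Ω) • n := by
  set r := infDist x (frontier Ω) with hr
  rcases (infDist_nonneg (x := x) (s := frontier Ω)).eq_or_lt with h0 | hpos
  · rw [← hr] at h0
    rw [← h0, eq_comm, dist_eq_zero] at hξx
    rw [← h0, zero_smul, sub_zero, hξx]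
  · have hball : ball x r ⊆ Ω := by
      by_contra hsub
      obtain ⟨y, hy, hyΩ⟩ := not_subset.1 hsub
      obtain ⟨z, hz, hzf⟩ : (ball x r ∩ frontier Ω).Nonempty := by
        by_contra hemp
        have hcover : ball x r ⊆ interior Ω ∪ (closure Ω)ᶜ := fun z hz ↦ by
          by_contra hz'
          simp only [mem_union, mem_compl_iff, not_or, not_not] at hz'
          exact hemp ⟨z, hz, hz'.2, hz'.1⟩
        obtain ⟨z, -, hz1, hz2⟩ := (convex_ball x r).isPreconnected _ _ isOpen_interior
          isClosed_closure.isOpen_compl hcover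
          ⟨x, mem_ball_self hpos, (hcover (mem_ball_self hpos)).resolve_right
            (not_not.2 (subset_closure hx))⟩
          ⟨y, hy, (hcover hy).resolve_left fun h ↦ hyΩ (interior_subset h)⟩
        exact hz2 (subset_closure (interior_subset hz1))
      have := infDist_le_dist_of_mem (x := x) hzf
      rw [mem_ball, dist_comm] at hz
      linarith
    have h1 := add_le_dist_of_ball_subset_compl hpos hκ hball he
    rw [dist_comm, dist_eq_norm, show ξ + κ • n - x = (ξ - x) + κ • n by module] at h1
    have h2 := mul_self_le_mul_self (by positivity) h1
    have hnx : ‖ξ - x‖ = r := by rw [hξx, dist_comm, dist_eq_norm]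
    rw [← sq (‖_‖), norm_add_sq_real, hnx, norm_smul, hn, Real.norm_of_nonneg hκ.le,
      real_inner_smul_right] at h2
    have h3 : r ≤ inner ℝ (ξ - x) n := by
      refine le_of_mul_le_mul_left ?_ hκ
      linarith
    have h4 : ‖ξ - x - r • n‖ ^ 2 ≤ 0 := by
      rw [norm_sub_sq_real, hnx, norm_smul, hn, Real.norm_of_nonneg hpos.le,
        real_inner_smul_right]
      nlinarith
    have h5 : ξ - x - r • n = 0 := by
      rw [← norm_eq_zero]
      exact pow_eq_zero_iff two_ne_zero |>.1 (le_antisymm h4 (sq_nonneg _))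
    rw [← sub_eq_zero, ← neg_eq_zero, ← h5]
    module

end TwoSidedBall

/-- On a compact `C²`-domain, `ρ_Ω` is dominated by the pullback of the Euclidean metric along a
bounded map into `ℝ^d`. -/
lemma exists_rhoMetric_le_mul_dist {d : ℕ} (hd : 2 ≤ d) {Ω : Set (EuclideanSpace ℝ (Fin d))}
    {ν : EuclideanSpace ℝ (Fin d) → EuclideanSpace ℝ (Fin d)} (hΩ : IsCompactC2Domain Ω ν) :
    ∃ (T : EuclideanSpace ℝ (Fin d) → EuclideanSpace ℝ (Fin d)) (K R : ℝ), 0 < K ∧ 0 ≤ R ∧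
      (∀ x ∈ Ω, ‖T x‖ ≤ R) ∧ ∀ x ∈ Ω, ∀ y ∈ Ω, rhoMetric Ω x y ≤ K * dist (T x) (T y) := by
  obtain ⟨hcomp, κ, hκ, -, -, -, -, -, hball⟩ := hΩ
  have hfc : IsCompact (frontier Ω) :=
    hcomp.of_isClosed_subset isClosed_frontier hcomp.isClosed.frontier_subset
  have hne : ∀ x ∈ Ω, (frontier Ω).Nonempty := fun x hx ↦ by
    have : Nonempty (Fin d) := ⟨⟨0, by omega⟩⟩
    rw [nonempty_frontier_iff]
    exact ⟨⟨x, hx⟩, hcomp.ne_univ⟩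
  have hproj : ∀ x, ∃ ξ, x ∈ Ω → ξ ∈ frontier Ω ∧ infDist x (frontier Ω) = dist x ξ := by
    intro x
    by_cases hx : x ∈ Ω
    · obtain ⟨ξ, h⟩ := hfc.exists_infDist_eq_dist (hne x hx) x
      exact ⟨ξ, fun _ ↦ h⟩
    · exact ⟨x, fun h ↦ (hx h).elim⟩
  choose p hp using hproj
  obtain ⟨M₀, hM₀⟩ := hcomp.exists_bound_of_continuousOn
    (f := fun x ↦ √(infDist x (frontier Ω)))
    (Real.continuous_sqrt.comp (continuous_infDist_pt _)).continuousOn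
  obtain ⟨B, hB⟩ := hcomp.isBounded.exists_norm_le
  set q : EuclideanSpace ℝ (Fin d) → ℝ := fun x ↦ √(infDist x (frontier Ω))
  have hq0 : ∀ x, 0 ≤ q x := fun x ↦ Real.sqrt_nonneg _
  have hqsq : ∀ x, infDist x (frontier Ω) = q x ^ 2 := fun x ↦ (Real.sq_sqrt infDist_nonneg).symm
  obtain ⟨M, hM, hqM⟩ : ∃ M : ℝ, 0 < M ∧ ∀ x ∈ Ω, q x ≤ M :=
    ⟨max M₀ 1, by positivity, fun x hx ↦
      ((le_abs_self _).trans (hM₀ x hx)).trans (le_max_left _ _)⟩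
  obtain ⟨c, hc, hcM⟩ : ∃ c : ℝ, 0 < c ∧ c * M = κ / 2 :=
    ⟨κ / (2 * M), by positivity, by field_simp⟩
  have hcq0 : ∀ x, 0 ≤ c * q x := fun x ↦ mul_nonneg hc.le (hq0 x)
  have hcq : ∀ x ∈ Ω, c * q x ≤ κ / 2 := fun x hx ↦
    hcM ▸ mul_le_mul_of_nonneg_left (hqM x hx) hc.le
  refine ⟨fun x ↦ p x - (c * q x) • ν (p x), (1 + M ^ 2 / κ) * 4 + (2 * M + 1) / c,
    max B 0 + κ / 2, by positivity, by positivity, fun x hx ↦ ?_, fun x hx y hy ↦ ?_⟩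
  · obtain ⟨hpx, -⟩ := hp x hx
    have h1 := hB _ (hcomp.isClosed.frontier_subset hpx)
    have h2 := norm_sub_le (p x) ((c * q x) • ν (p x))
    rw [norm_smul, (hball _ hpx).1, Real.norm_of_nonneg (hcq0 x), mul_one] at h2
    linarith [le_max_left B 0, hcq x hx]
  · obtain ⟨hpx, hpx'⟩ := hp x hx
    obtain ⟨hpy, hpy'⟩ := hp y hy
    obtain ⟨hnx, hix, hex⟩ := hball _ hpx
    obtain ⟨hny, hiy, hey⟩ := hball _ hpy
    have hx' := eq_sub_infDist_smul_normal hκ hx hpx' hnx hex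
    have hy' := eq_sub_infDist_smul_normal hκ hy hpy' hny hey
    have hν := norm_normal_sub_le (ν := ν) hκ hnx hny hix hex hiy hey
    have hTx := infDist_sub_smul_normal hpx hnx hix (hcq0 x) (by linarith [hcq x hx])
    have hTy := infDist_sub_smul_normal hpy hny hiy (hcq0 y) (by linarith [hcq y hy])
    have hst : |c * q x - c * q y| ≤
        dist (p x - (c * q x) • ν (p x)) (p y - (c * q y) • ν (p y)) := by
      have := (lipschitz_infDist_pt (frontier Ω)).dist_le_mul
        (p x - (c * q x) • ν (p x)) (p y - (c * q y) • ν (p y))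
      rwa [hTx, hTy, NNReal.coe_one, one_mul, Real.dist_eq] at this
    rw [← mul_sub, abs_mul, abs_of_pos hc] at hst
    have hsplit : ∀ a b : ℝ, 0 ≤ a →
        ‖a • ν (p x) - b • ν (p y)‖ ≤ a / κ * ‖p x - p y‖ + |a - b| := by
      intro a b ha
      rw [show a • ν (p x) - b • ν (p y) = a • (ν (p x) - ν (p y)) + (a - b) • ν (p y) by module]
      refine (norm_add_le _ _).trans ?_
      rw [norm_smul, norm_smul, hny, Real.norm_of_nonneg ha, mul_one, Real.norm_eq_abs]
      rw [div_mul_eq_mul_div, mul_div_assoc]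
      have : ‖ν (p x) - ν (p y)‖ ≤ ‖p x - p y‖ / κ := by rwa [le_div_iff₀' hκ]
      gcongr
    rw [dist_eq_norm] at hst ⊢
    set D := ‖p x - (c * q x) • ν (p x) - (p y - (c * q y) • ν (p y))‖
    have hpp : ‖p x - p y‖ ≤ 4 * D := by
      have h1 : ‖p x - p y‖ ≤ D + ‖(c * q x) • ν (p x) - (c * q y) • ν (p y)‖ := by
        refine le_trans (le_of_eq ?_) (norm_add_le _ _)
        congr 1
        module
      have h2 := hsplit (c * q x) (c * q y) (hcq0 x)
      rw [← mul_sub, abs_mul, abs_of_pos hc] at h2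
      have h3 : c * q x / κ * ‖p x - p y‖ ≤ 1 / 2 * ‖p x - p y‖ := by
        refine mul_le_mul_of_nonneg_right ?_ (norm_nonneg _)
        rw [div_le_iff₀ hκ]
        linarith [hcq x hx]
      linarith
    have hqq : |q x - q y| ≤ D / c := by rwa [le_div_iff₀' hc]
    have hxy : dist x y ≤ (1 + M ^ 2 / κ) * ‖p x - p y‖ + 2 * M * |q x - q y| := by
      have h1 : dist x y ≤ ‖p x - p y‖ + ‖q x ^ 2 • ν (p x) - q y ^ 2 • ν (p y)‖ := by
        rw [dist_eq_norm, ← hqsq, ← hqsq]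
        refine le_trans (le_of_eq ?_) (norm_sub_le _ _)
        congr 1
        nth_rewrite 1 [hx']
        nth_rewrite 1 [hy']
        module
      have h2 := hsplit (q x ^ 2) (q y ^ 2) (sq_nonneg _)
      have h3 : q x ^ 2 / κ * ‖p x - p y‖ ≤ M ^ 2 / κ * ‖p x - p y‖ := by
        have := hq0 x
        have := hqM x hx
        gcongr
      have h4 : |q x ^ 2 - q y ^ 2| ≤ 2 * M * |q x - q y| := by
        rw [sq_sub_sq, abs_mul, abs_of_nonneg (add_nonneg (hq0 x) (hq0 y))]
        gcongr
        linarith [hqM x hx, hqM y hy]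
      linarith
    calc rhoMetric Ω x y = dist x y + |q x - q y| := rfl
      _ ≤ (1 + M ^ 2 / κ) * ‖p x - p y‖ + (2 * M + 1) * |q x - q y| := by linarith
      _ ≤ (1 + M ^ 2 / κ) * (4 * D) + (2 * M + 1) * (D / c) := by gcongr
      _ = ((1 + M ^ 2 / κ) * 4 + (2 * M + 1) / c) * D := by ring


/-- **Corollary 3.4(iii)**: every `δ`-separated subset of `Ω` with respect to `ρ_Ω` has
cardinality at most `C δ^{-d}`. -/
theorem card_separated_le {d : ℕ} (hd : 2 ≤ d)
    (Ω : Set (EuclideanSpace ℝ (Fin d)))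
    (ν : EuclideanSpace ℝ (Fin d) → EuclideanSpace ℝ (Fin d))
    (hΩ : IsCompactC2Domain Ω ν) :
    ∃ C : ℝ, 1 < C ∧ ∀ δ : ℝ, 0 < δ → δ < 1 →
      ∀ Λ : Finset (EuclideanSpace ℝ (Fin d)),
        (↑Λ : Set (EuclideanSpace ℝ (Fin d))) ⊆ Ω →
        (∀ ω ∈ Λ, ∀ ω' ∈ Λ, ω ≠ ω' → δ ≤ rhoMetric Ω ω ω') →
        (Λ.card : ℝ) ≤ C * δ⁻¹ ^ d := by
  obtain ⟨T, K, R, hK, hR, hTR, hT⟩ := exists_rhoMetric_le_mul_dist hd hΩ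
  refine ⟨(2 * R * K + 1) ^ d + 1, by linarith [show 0 < (2 * R * K + 1) ^ d by positivity],
    fun δ hδ hδ1 Λ hΛ hsep ↦ ?_⟩
  have hcard := card_le_pow_of_separated Λ T hR (div_pos hδ hK)
    (fun x hx ↦ hTR x (hΛ hx)) fun x hx y hy hxy ↦ by
      rw [div_le_iff₀' hK]
      exact (hsep x hx y hy hxy).trans (hT x (hΛ hx) y (hΛ hy))
  refine hcard.trans ?_
  have hbase : (2 * R + δ / K) / (δ / K) ≤ (2 * R * K + 1) * δ⁻¹ := by
    rw [← div_eq_mul_inv, le_div_iff₀ hδ]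
    have : (2 * R + δ / K) / (δ / K) * δ = 2 * R * K + δ := by field_simp
    linarith
  calc ((2 * R + δ / K) / (δ / K)) ^ d ≤ ((2 * R * K + 1) * δ⁻¹) ^ d := by gcongr
    _ = (2 * R * K + 1) ^ d * δ⁻¹ ^ d := mul_pow _ _ _
    _ ≤ ((2 * R * K + 1) ^ d + 1) * δ⁻¹ ^ d := by gcongr; linarith
end
end
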